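/- N_R(M) ≥ Σ_{i=0}^{d} dim_k Soc(H^i_m(M)). -/

import Mathlib

open IsLocalRing

universe u

namespace Paper

variable (R : Type u) [CommRing R]

/-- `dim_{R/I} Soc_I(N)` where `Soc_I(N) = (0 :_N I)`. -/
noncomputable def socDim (I : Ideal R) (N : Type u) [AddCommGroup N] [Module R N] : ℕ :=
  Module.finrank (R ⧸ I) (Submodule.torsionBySet R N (I : Set R))

/-- Krull dimension of a module (`⊥` for the zero module). -/
noncomputable def mdim (M : Type u) [AddCommGroup M] [Module R M] : WithBot (WithTop ℕ) :=
  ringKrullDim (R ⧸ Module.annihilator R M)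

/-- The index of reducibility of an ideal `q` on `M`: `dim_k Soc (M/qM)`. -/
noncomputable def ir [IsLocalRing R] (M : Type u) [AddCommGroup M] [Module R M]
    (q : Ideal R) : ℕ :=
  socDim R (maximalIdeal R) (M ⧸ (q • ⊤ : Submodule R M))

/-- `dim_k Soc (H^i_m(M))`. -/
noncomputable def socH [IsLocalRing R] (M : Type u) [AddCommGroup M] [Module R M] (i : ℕ) : ℕ :=
  socDim R (maximalIdeal R) ((localCohomology (maximalIdeal R) i).obj (ModuleCat.of R M))

/-- A system of parameters of `M` (of length `d`): `d` elements of the maximal ideal such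
that the quotient has finite length. -/
def IsSOP [IsLocalRing R] (M : Type u) [AddCommGroup M] [Module R M] (d : ℕ)
    (x : Fin d → R) : Prop :=
  (∀ i, x i ∈ maximalIdeal R) ∧
    IsFiniteLength R (M ⧸ (Ideal.span (Set.range x) • ⊤ : Submodule R M))

/-- A parameter element: an element occurring in some system of parameters of `M`. -/
def IsParamElement [IsLocalRing R] (M : Type u) [AddCommGroup M] [Module R M] (d : ℕ)
    (a : R) : Prop :=
  ∃ x : Fin d → R, IsSOP R M d x ∧ ∃ i, x i = a

/-- The ideal `b(M) = ⋂ Ann (0 :_{M/(x_1,...,x_{i-1})M} x_i)`, the intersection running over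
all systems of parameters `x_1, ..., x_d` of `M`. -/
noncomputable def bIdeal [IsLocalRing R] (M : Type u) [AddCommGroup M] [Module R M]
    (d : ℕ) : Ideal R :=
  ⨅ (x : Fin d → R) (_ : IsSOP R M d x) (i : Fin d),
    Module.annihilator R
      (Submodule.torsionBy R (M ⧸ (Ideal.span (x '' {j | j < i}) • ⊤ : Submodule R M)) (x i))

/-- A C-system of parameters: `x_i ∈ b(M/(x_{i+1},...,x_d)M)^3` for all `i`. -/
def IsCSOP [IsLocalRing R] (M : Type u) [AddCommGroup M] [Module R M] (d : ℕ)
    (x : Fin d → R) : Prop :=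
  IsSOP R M d x ∧ ∀ i : Fin d,
    x i ∈ (bIdeal R (M ⧸ (Ideal.span (x '' {j | i < j}) • ⊤ : Submodule R M)) ((i : ℕ) + 1)) ^ 3

/-- The depth of `M`: the supremum of the lengths of `M`-regular sequences contained in the
maximal ideal. -/
noncomputable def depth [IsLocalRing R] (M : Type u) [AddCommGroup M] [Module R M] :
    WithTop ℕ :=
  sSup {n : WithTop ℕ | ∃ rs : List R, (rs.length : WithTop ℕ) = n ∧
    (∀ r ∈ rs, r ∈ maximalIdeal R) ∧ RingTheory.Sequence.IsRegular M rs}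

/-- `M` is a Cohen-Macaulay module: `depth M = dim M`. -/
def IsCM [IsLocalRing R] (M : Type u) [AddCommGroup M] [Module R M] : Prop :=
  (depth R M : WithBot (WithTop ℕ)) = mdim R M

/-- A Cohen-Macaulay local ring. -/
def IsCMLocalRing (S : Type u) [CommRing S] [IsLocalRing S] : Prop :=
  IsNoetherianRing S ∧ IsCM S S

/-- `R` is a homomorphic image of a Cohen-Macaulay (Noetherian) local ring. -/
def IsQuotientOfCMLocalRing : Prop :=
  ∃ (S : Type u) (_ : CommRing S) (_ : IsLocalRing S),
    IsCMLocalRing S ∧ ∃ f : S →+* R, Function.Surjective f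

/-- The largest submodule of (the submodule) `N` whose dimension is strictly smaller than
that of `N`. -/
noncomputable def uComp (M : Type u) [AddCommGroup M] [Module R M] (N : Submodule R M) :
    Submodule R M :=
  sSup {P : Submodule R M | P ≤ N ∧ mdim R P < mdim R N}

/-- The unmixed component `U_M(0)` of `M`: the largest submodule of dimension `< dim M`. -/
noncomputable def unmixedComp (M : Type u) [AddCommGroup M] [Module R M] : Submodule R M :=
  uComp R M ⊤

/-- The 0-th local cohomology `H^0_m(M)` realized as the submodule of elements annihilated by
some power of the maximal ideal. -/
def H0sub [IsLocalRing R] (M : Type u) [AddCommGroup M] [Module R M] : Submodule R M :=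
  ⨆ n : ℕ, Submodule.torsionBySet R M (((maximalIdeal R) ^ n : Ideal R) : Set R)

/-- The quotient `P/N` of two submodules of `M`. -/
abbrev subQuot (M : Type u) [AddCommGroup M] [Module R M] (P N : Submodule R M) :=
  P ⧸ (Submodule.comap P.subtype N)

/-- `D_0 ⊆ D_1 ⊆ ⋯ ⊆ D_t = M` is the dimension filtration of `M`:
`D_t = M`, each `D_{i-1}` is the largest submodule of `D_i` of strictly smaller dimension,
and `D_0 = H^0_m(M)`. -/
def IsDimFiltration [IsLocalRing R] (M : Type u) [AddCommGroup M] [Module R M]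
    (t : ℕ) (D : Fin (t + 1) → Submodule R M) : Prop :=
  D (Fin.last t) = ⊤ ∧ (∀ i : Fin t, D i.castSucc = uComp R M (D i.succ)) ∧
    D 0 = H0sub R M

/-- `M` is sequentially Cohen-Macaulay: all quotients `D_i/D_{i-1}` of the dimension
filtration are Cohen-Macaulay. -/
def IsSeqCM [IsLocalRing R] (M : Type u) [AddCommGroup M] [Module R M] : Prop :=
  ∃ (t : ℕ) (D : Fin (t + 1) → Submodule R M), IsDimFiltration R M t D ∧
    ∀ i : Fin t, IsCM R (subQuot R M (D i.succ) (D i.castSucc))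

/-- `M` (of dimension `d`) is generalized Cohen-Macaulay: `H^i_m(M)` has finite length
for all `i < d`. -/
def IsGenCM [IsLocalRing R] (M : Type u) [AddCommGroup M] [Module R M] (d : ℕ) : Prop :=
  ∀ i < d, IsFiniteLength R ((localCohomology (maximalIdeal R) i).obj (ModuleCat.of R M))

/-- `α_n(M)`: the minimum of the indices of reducibility of parameter ideals of `M`
contained in `m^n`. -/
noncomputable def alphaN [IsLocalRing R] (M : Type u) [AddCommGroup M] [Module R M]
    (d n : ℕ) : ℕ :=
  sInf {r : ℕ | ∃ x : Fin d → R, IsSOP R M d x ∧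
    Ideal.span (Set.range x) ≤ (maximalIdeal R) ^ n ∧ r = ir R M (Ideal.span (Set.range x))}

/-- The limit value `α(M) = lim_n α_n(M)` (the supremum of the non-decreasing sequence). -/
noncomputable def alphaLim [IsLocalRing R] (M : Type u) [AddCommGroup M] [Module R M]
    (d : ℕ) : ℕ :=
  ⨆ n : ℕ, alphaN R M d (n + 1)

/-- `M` is unmixed: `dim R/p = dim M` for all associated primes `p`. -/
def IsUnmixed (M : Type u) [AddCommGroup M] [Module R M] : Prop :=
  ∀ p ∈ associatedPrimes R M, ringKrullDim (R ⧸ p) = mdim R M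

/-- Serre's condition `(S_2)` for a module. -/
def IsS2 (L : Type u) [AddCommGroup L] [Module R L] : Prop :=
  ∀ p : PrimeSpectrum R, p ∈ Module.support R L →
    min 2 (mdim (Localization.AtPrime p.asIdeal) (LocalizedModule p.asIdeal.primeCompl L)) ≤
      (depth (Localization.AtPrime p.asIdeal) (LocalizedModule p.asIdeal.primeCompl L) :
        WithBot (WithTop ℕ))

/-- `ι : M →ₗ[R] S` exhibits `S` as an `S_2`-ification of `M`. -/
def IsS2ification [IsLocalRing R] (M S : Type u) [AddCommGroup M] [Module R M]
    [AddCommGroup S] [Module R S] (ι : M →ₗ[R] S) : Prop :=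
  Function.Injective ι ∧ Module.Finite R S ∧ IsS2 R S ∧
    ∀ (p : Ideal R) [p.IsPrime], p ≠ maximalIdeal R →
      IsS2 (Localization.AtPrime p) (LocalizedModule p.primeCompl M) →
      Function.Surjective (IsLocalizedModule.map p.primeCompl
        (LocalizedModule.mkLinearMap p.primeCompl M)
        (LocalizedModule.mkLinearMap p.primeCompl S) ι)

end Paper

open Paper IsLocalRing


namespace LC
open CategoryTheory Abelian Limits Opposite

noncomputable section

section OldNew
variable {R : Type u} [CommRing R]

section cplx
variable (K : ChainComplex (ModuleCat.{u} R)ᵒᵖ ℕ) (i : ℕ)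

/-- inclusion of cocycles -/
def pL : (K.opcycles i).unop →ₗ[R] (K.X i).unop := (K.pOpcycles i).unop.hom

/-- projection from cocycles to cohomology -/
def qL : (K.opcycles i).unop →ₗ[R] (K.homology i).unop := (K.homologyι i).unop.hom

lemma pL_inj : Function.Injective (pL K i) :=
  (ModuleCat.mono_iff_injective _).1 (inferInstanceAs (Mono (K.pOpcycles i).unop))

lemma qL_surj : Function.Surjective (qL K i) :=
  (ModuleCat.epi_iff_surjective _).1 (inferInstanceAs (Epi (K.homologyι i).unop))

lemma pL_range (f : (K.X i).unop) (hf : (K.d (i+1) i).unop.hom f = 0) : ∃ z, pL K i z = f := by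
  have h := ShortComplex.exact_of_g_is_cokernel
    (ShortComplex.mk (K.d (i+1) i) (K.pOpcycles i) (by simp)) (K.opcyclesIsCokernel (i+1) i (by simp))
  exact (ShortComplex.moduleCat_exact_iff _).1 h.unop f hf

lemma d_pL (z) : (K.d (i+1) i).unop.hom (pL K i z) = 0 := by
  have h : (K.pOpcycles i).unop ≫ (K.d (i+1) i).unop = 0 := by
    rw [← unop_comp]; simp
  exact LinearMap.congr_fun (ModuleCat.hom_ext_iff.1 h) z

lemma qL_eq_zero (z) (j : ℕ) (hj : (ComplexShape.down ℕ).next i = j) :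
    qL K i z = 0 ↔ ∃ w, (K.d i j).unop.hom w = pL K i z := by
  have h := ShortComplex.exact_of_f_is_kernel
    (ShortComplex.mk (K.homologyι i) (K.fromOpcycles i j) (by simp)) (K.homologyIsKernel i j hj)
  have h2 : (K.fromOpcycles i j).unop ≫ (K.pOpcycles i).unop = (K.d i j).unop := by
    rw [← unop_comp]; simp
  have h3 : ∀ w, pL K i ((K.fromOpcycles i j).unop.hom w) = (K.d i j).unop.hom w :=
    fun w => LinearMap.congr_fun (ModuleCat.hom_ext_iff.1 h2) w
  have h4 : (K.fromOpcycles i j).unop ≫ (K.homologyι i).unop = 0 := by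
    rw [← unop_comp]; simp
  constructor
  · intro hz
    obtain ⟨w, hw⟩ := (ShortComplex.moduleCat_exact_iff _).1 h.unop z hz
    exact ⟨w, (h3 w).symm.trans (congrArg (pL K i) hw)⟩
  · rintro ⟨w, hw⟩
    rw [← h3] at hw
    rw [← pL_inj K i hw]
    exact LinearMap.congr_fun (ModuleCat.hom_ext_iff.1 h4) w

variable {K} {L : ChainComplex (ModuleCat.{u} R)ᵒᵖ ℕ} (φ : K ⟶ L)

lemma pL_map (z : (L.opcycles i).unop) :
    pL K i ((HomologicalComplex.opcyclesMap φ i).unop.hom z) = (φ.f i).unop.hom (pL L i z) := by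
  have h : (HomologicalComplex.opcyclesMap φ i).unop ≫ (K.pOpcycles i).unop =
      (L.pOpcycles i).unop ≫ (φ.f i).unop := by
    rw [← unop_comp, ← unop_comp]; simp
  exact LinearMap.congr_fun (ModuleCat.hom_ext_iff.1 h) z

lemma qL_map (z : (L.opcycles i).unop) :
    qL K i ((HomologicalComplex.opcyclesMap φ i).unop.hom z) =
      (HomologicalComplex.homologyMap φ i).unop.hom (qL L i z) := by
  have h : (HomologicalComplex.opcyclesMap φ i).unop ≫ (K.homologyι i).unop =
      (L.homologyι i).unop ≫ (HomologicalComplex.homologyMap φ i).unop := by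
    rw [← unop_comp, ← unop_comp]; simp
  exact LinearMap.congr_fun (ModuleCat.hom_ext_iff.1 h) z
end cplx

lemma extMk_eq_zero_iff_zero {X Y : ModuleCat.{u} R} (P : ProjectiveResolution X)
    (f : P.complex.X 0 ⟶ Y) (hf : P.complex.d 1 0 ≫ f = 0) :
    P.extMk f 1 rfl hf = 0 ↔ f = 0 := by
  simp only [← P.extEquivCohomologyClass.apply_eq_iff_eq,
    ProjectiveResolution.extEquivCohomologyClass_extMk,
    ProjectiveResolution.extEquivCohomologyClass_zero,
    CochainComplex.HomComplex.CohomologyClass.mk_eq_zero_iff]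
  rw [CochainComplex.HomComplex.Cocycle.toSingleMk_mem_coboundaries_iff _ _ _ _ _ 1 (by simp)]
  have hz : IsZero (P.cochainComplex.X 1) := CochainComplex.isZero_of_isStrictlyLE _ 0 _
  constructor
  · rintro ⟨g, hg⟩
    rw [← cancel_epi (P.cochainComplexXIso (-(0:ℕ)) 0 rfl).hom, ← hg, hz.eq_of_src g 0]
    simp
  · rintro rfl
    exact ⟨0, by simp⟩

/-- the chain complex in the opposite category -/
abbrev KK (M : ModuleCat.{u} R) (P : ChainComplex (ModuleCat.{u} R) ℕ) :
    ChainComplex (ModuleCat.{u} R)ᵒᵖ ℕ :=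
  (((linearYoneda R (ModuleCat.{u} R)).obj M).rightOp.mapHomologicalComplex _).obj P

lemma smul_extMk {X Y : ModuleCat.{u} R} (P : ProjectiveResolution X) (n : ℕ)
    (f : P.complex.X n ⟶ Y) (hf : P.complex.d (n+1) n ≫ f = 0) (r : R) :
    P.extMk (r • f) (n+1) rfl (by simp [hf]) = r • P.extMk f (n+1) rfl hf := by
  rw [Ext.smul_eq_comp_mk₀, ProjectiveResolution.extMk_comp_mk₀]
  congr 1

/-- the homomorphism underlying a cocycle -/
def zHom {X : ModuleCat.{u} R} (M : ModuleCat.{u} R) (P : ProjectiveResolution X) (i : ℕ)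
    (z : ((KK M P.complex).opcycles i).unop) : P.complex.X i ⟶ M :=
  pL (KK M P.complex) i z

lemma zHom_add {X : ModuleCat.{u} R} (M : ModuleCat.{u} R) (P : ProjectiveResolution X) (i : ℕ)
    (z w : ((KK M P.complex).opcycles i).unop) : zHom M P i (z + w) = zHom M P i z + zHom M P i w :=
  map_add (pL (KK M P.complex) i) z w

lemma zHom_smul {X : ModuleCat.{u} R} (M : ModuleCat.{u} R) (P : ProjectiveResolution X) (i : ℕ)
    (r : R) (z : ((KK M P.complex).opcycles i).unop) : zHom M P i (r • z) = r • zHom M P i z :=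
  map_smul (pL (KK M P.complex) i) r z

lemma d_zHom {X : ModuleCat.{u} R} (M : ModuleCat.{u} R) (P : ProjectiveResolution X) (i : ℕ)
    (z : ((KK M P.complex).opcycles i).unop) : P.complex.d (i+1) i ≫ zHom M P i z = 0 :=
  d_pL (KK M P.complex) i z

lemma extMk_congr {X Y : ModuleCat.{u} R} (P : ProjectiveResolution X) (n : ℕ)
    (f g : P.complex.X n ⟶ Y) (hf : P.complex.d (n+1) n ≫ f = 0)
    (hg : P.complex.d (n+1) n ≫ g = 0) (h : f = g) :
    P.extMk f (n+1) rfl hf = P.extMk g (n+1) rfl hg := by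
  subst h; rfl

/-- cocycles to new Ext -/
def newMap {X : ModuleCat.{u} R} (M : ModuleCat.{u} R) (P : ProjectiveResolution X) (i : ℕ) :
    ((KK M P.complex).opcycles i).unop →ₗ[R] Abelian.Ext.{u} X M i where
  toFun z := P.extMk (zHom M P i z) (i+1) rfl (d_zHom M P i z)
  map_add' z w := by
    rw [ProjectiveResolution.add_extMk]
    exact extMk_congr _ _ _ _ _ _ (zHom_add _ _ _ _ _)
  map_smul' r z := by
    rw [RingHom.id_apply, ← smul_extMk]
    exact extMk_congr _ _ _ _ _ _ (zHom_smul _ _ _ _ _)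

lemma newMap_apply {X : ModuleCat.{u} R} (M : ModuleCat.{u} R) (P : ProjectiveResolution X) (i : ℕ)
    (z) : newMap M P i z = P.extMk (zHom M P i z) (i+1) rfl (d_zHom M P i z) := rfl

lemma newMap_surj {X : ModuleCat.{u} R} (M : ModuleCat.{u} R) (P : ProjectiveResolution X) (i : ℕ) :
    Function.Surjective (newMap M P i) := by
  intro e
  obtain ⟨f, hf, rfl⟩ := P.extMk_surjective e (i+1) rfl
  obtain ⟨z, hz⟩ := pL_range (KK M P.complex) i f hf
  exact ⟨z, extMk_congr _ _ _ _ (d_zHom M P i z) hf hz⟩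

lemma newMap_ker {X : ModuleCat.{u} R} (M : ModuleCat.{u} R) (P : ProjectiveResolution X) (i : ℕ) :
    LinearMap.ker (qL (KK M P.complex) i) = LinearMap.ker (newMap M P i) := by
  ext z
  rw [LinearMap.mem_ker, LinearMap.mem_ker, newMap_apply]
  rcases i with _ | i
  · rw [extMk_eq_zero_iff_zero, qL_eq_zero _ _ _ 0 (by simp)]
    rw [HomologicalComplex.shape _ _ _ (by simp)]
    constructor
    · rintro ⟨w, hw⟩
      exact hw.symm
    · intro h
      exact ⟨0, h.symm⟩
  · rw [ProjectiveResolution.extMk_eq_zero_iff _ _ _ _ _ i rfl, qL_eq_zero _ _ _ i (by simp)]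
    rfl

/-- comparison of the two Ext groups, for a given resolution -/
def oldNewAux {X : ModuleCat.{u} R} (M : ModuleCat.{u} R) (P : ProjectiveResolution X) (i : ℕ) :
    ((KK M P.complex).homology i).unop ≃ₗ[R] Abelian.Ext.{u} X M i :=
  ((qL (KK M P.complex) i).quotKerEquivOfSurjective (qL_surj _ _)).symm.trans
    ((Submodule.quotEquivOfEq _ _ (newMap_ker M P i)).trans
      ((newMap M P i).quotKerEquivOfSurjective (newMap_surj M P i)))

lemma oldNewAux_apply {X : ModuleCat.{u} R} (M : ModuleCat.{u} R) (P : ProjectiveResolution X)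
    (i : ℕ) (z) : oldNewAux M P i (qL (KK M P.complex) i z) = newMap M P i z := by
  have : qL (KK M P.complex) i z = (qL (KK M P.complex) i).quotKerEquivOfSurjective (qL_surj _ _)
    (Submodule.Quotient.mk z) := rfl
  rw [this]
  simp only [oldNewAux, LinearEquiv.trans_apply, LinearEquiv.symm_apply_apply]
  rfl

/-- comparison of the two Ext groups -/
def oldNew (X M : ModuleCat.{u} R) (i : ℕ) :
    ((_root_.Ext R (ModuleCat.{u} R) i).obj (op X)).obj M ≃ₗ[R] Abelian.Ext.{u} X M i :=
  (((projectiveResolution X).isoLeftDerivedObj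
    ((linearYoneda R (ModuleCat.{u} R)).obj M).rightOp i).unop.symm.toLinearEquiv).trans
    (oldNewAux M _ i)

lemma oldNew_naturality {X X' : ModuleCat.{u} R} (g : X' ⟶ X) (M : ModuleCat.{u} R) (i : ℕ)
    (e : ((_root_.Ext R (ModuleCat.{u} R) i).obj (op X)).obj M) :
    oldNew X' M i ((((_root_.Ext R (ModuleCat.{u} R) i).map g.op).app M).hom e) =
      (Ext.mk₀ g).comp (oldNew X M i e) (zero_add i) := by
  let P := projectiveResolution X
  let P' := projectiveResolution X'
  let φ : P'.complex ⟶ P.complex := ProjectiveResolution.lift g P' P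
  let F := ((linearYoneda R (ModuleCat.{u} R)).obj M).rightOp
  have hφ : φ.f 0 ≫ P.π.f 0 = P'.π.f 0 ≫ g :=
    ProjectiveResolution.lift_commutes_zero g P' P
  have hnat := ProjectiveResolution.isoLeftDerivedObj_inv_naturality g P' P φ hφ F i
  have key : ∀ z : ((KK M P.complex).homology i).unop, 
     oldNewAux M P' i ((HomologicalComplex.homologyMap ((F.mapHomologicalComplex _).map φ) i).unop.hom z)
      = (Ext.mk₀ g).comp (oldNewAux M P i z) (zero_add i) := by
    intro z
    obtain ⟨z, rfl⟩ := qL_surj _ _ z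
    rw [← qL_map, oldNewAux_apply, oldNewAux_apply, newMap_apply, newMap_apply]
    rw [ProjectiveResolution.mk₀_comp_extMk _ _ _ _ (⟨φ, hφ⟩ : ProjectiveResolution.Hom P' P g)]
    exact extMk_congr _ _ _ _ (d_zHom M P' i _) _ (pL_map i _ z)
  have hnat' := congrArg Quiver.Hom.unop hnat
  have h2 : ((P'.isoLeftDerivedObj F i).inv.unop.hom
      ((((_root_.Ext R (ModuleCat.{u} R) i).map g.op).app M).hom e)) =
      (HomologicalComplex.homologyMap ((F.mapHomologicalComplex _).map φ) i).unop.hom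
        ((P.isoLeftDerivedObj F i).inv.unop.hom e) :=
    LinearMap.congr_fun (ModuleCat.hom_ext_iff.1 hnat') e
  exact (congrArg (oldNewAux M P' i) h2).trans (key _)
end OldNew
end
end LC

namespace LC
open CategoryTheory Abelian Limits Opposite

noncomputable section

section HDef
variable {R : Type u} [CommRing R] (I : Ideal R)

/-- the module R/I^n -/
abbrev Q (n : ℕ) : ModuleCat.{u} R := ModuleCat.of R (R ⧸ I ^ n)

/-- transition R/I^m to R/I^n -/
def tr {n m : ℕ} (h : n ≤ m) : Q I m ⟶ Q I n :=
  ModuleCat.ofHom (Submodule.mapQ (I ^ m) (I ^ n) LinearMap.id (Ideal.pow_le_pow_right h))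

lemma tr_refl (n : ℕ) : tr I (le_refl n) = 𝟙 _ := by
  apply ModuleCat.hom_ext
  apply Submodule.linearMap_qext
  rfl

lemma tr_comp {n m k : ℕ} (h : n ≤ m) (h' : m ≤ k) : tr I h' ≫ tr I h = tr I (h.trans h') := by
  apply ModuleCat.hom_ext
  apply Submodule.linearMap_qext
  rfl

/-- transition maps -/
def trE (M : ModuleCat.{u} R) (i : ℕ) (n m : ℕ) (h : n ≤ m) :
    Abelian.Ext.{u} (Q I n) M i →ₗ[R] Abelian.Ext.{u} (Q I m) M i :=
  Ext.precompOfLinear (Ext.mk₀ (tr I h)) R M (zero_add i)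

lemma trE_apply (M : ModuleCat.{u} R) (i : ℕ) (n m : ℕ) (h : n ≤ m) (e) :
    trE I M i n m h e = (Ext.mk₀ (tr I h)).comp e (zero_add i) := rfl

instance (M : ModuleCat.{u} R) (i : ℕ) :
    DirectedSystem (fun n => Abelian.Ext.{u} (Q I n) M i) (fun n m h => trE I M i n m h) where
  map_self n x := by rw [trE_apply, tr_refl, Ext.mk₀_id_comp]
  map_map k j i hij hjk x := by
    rw [trE_apply, trE_apply, trE_apply, Ext.mk₀_comp_mk₀_assoc, tr_comp]

/-- local cohomology as a direct limit -/
def H (M : ModuleCat.{u} R) (i : ℕ) : Type u :=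
  Module.DirectLimit (fun n => Abelian.Ext.{u} (Q I n) M i) (trE I M i)

instance (M : ModuleCat.{u} R) (i : ℕ) : AddCommGroup (H I M i) :=
  inferInstanceAs (AddCommGroup (Module.DirectLimit (fun n => Abelian.Ext.{u} (Q I n) M i) (trE I M i)))

instance (M : ModuleCat.{u} R) (i : ℕ) : Module R (H I M i) :=
  inferInstanceAs (Module R (Module.DirectLimit (fun n => Abelian.Ext.{u} (Q I n) M i) (trE I M i)))

/-- elements of the limit -/
def mkH (M : ModuleCat.{u} R) (i n : ℕ) : Abelian.Ext.{u} (Q I n) M i →ₗ[R] H I M i :=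
  Module.DirectLimit.of R ℕ (fun n => Abelian.Ext.{u} (Q I n) M i) (trE I M i) n

variable {I}

lemma mkH_surj {M : ModuleCat.{u} R} {i : ℕ} (h : H I M i) : ∃ n e, mkH I M i n e = h :=
  Module.DirectLimit.exists_of h

lemma mkH_tr {M : ModuleCat.{u} R} {i n m : ℕ} (h : n ≤ m) (e) :
    mkH I M i m ((Ext.mk₀ (tr I h)).comp e (zero_add i)) = mkH I M i n e :=
  Module.DirectLimit.of_f (hij := h)

lemma mkH_eq_zero {M : ModuleCat.{u} R} {i n : ℕ} {e} (h : mkH I M i n e = 0) :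
    ∃ (m : ℕ) (h : n ≤ m), (Ext.mk₀ (tr I h)).comp e (zero_add i) = 0 :=
  Module.DirectLimit.of.zero_exact h

/-- lifting -/
def liftH {M : ModuleCat.{u} R} {i : ℕ} {P : Type u} [AddCommGroup P] [Module R P]
    (g : ∀ n, Abelian.Ext.{u} (Q I n) M i →ₗ[R] P)
    (hg : ∀ n m (h : n ≤ m) e, g m ((Ext.mk₀ (tr I h)).comp e (zero_add i)) = g n e) :
    H I M i →ₗ[R] P :=
  Module.DirectLimit.lift R ℕ _ _ g hg

lemma liftH_mk {M : ModuleCat.{u} R} {i : ℕ} {P : Type u} [AddCommGroup P] [Module R P]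
    (g : ∀ n, Abelian.Ext.{u} (Q I n) M i →ₗ[R] P)
    (hg : ∀ n m (h : n ≤ m) e, g m ((Ext.mk₀ (tr I h)).comp e (zero_add i)) = g n e) (n e) :
    liftH g hg (mkH I M i n e) = g n e :=
  Module.DirectLimit.lift_of _ _ _

lemma liftH_inj {M : ModuleCat.{u} R} {i : ℕ} {P : Type u} [AddCommGroup P] [Module R P]
    (g : ∀ n, Abelian.Ext.{u} (Q I n) M i →ₗ[R] P)
    (hg : ∀ n m (h : n ≤ m) e, g m ((Ext.mk₀ (tr I h)).comp e (zero_add i)) = g n e)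
    (hz : ∀ n e, g n e = 0 → ∃ (m : ℕ) (h : n ≤ m), (Ext.mk₀ (tr I h)).comp e (zero_add i) = 0) :
    Function.Injective (liftH g hg) := by
  rw [injective_iff_map_eq_zero]
  intro h hh
  obtain ⟨n, e, rfl⟩ := mkH_surj h
  rw [liftH_mk] at hh
  obtain ⟨m, hm, h0⟩ := hz n e hh
  rw [← mkH_tr hm, h0, map_zero]

/-- the right action of Ext -/
def act {M N : ModuleCat.{u} R} {i j k : ℕ} (α : Abelian.Ext.{u} M N j) (hk : i + j = k) :
    H I M i →ₗ[R] H I N k :=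
  liftH (fun n => (mkH I N k n).comp (Ext.postcompOfLinear α R (Q I n) hk)) (by
    intro n m h e
    change mkH I N k m (((Ext.mk₀ (tr I h)).comp e (zero_add i)).comp α hk) =
      mkH I N k n (e.comp α hk)
    rw [Ext.comp_assoc _ _ _ _ hk (by lia), mkH_tr])

lemma act_mk {M N : ModuleCat.{u} R} {i j k : ℕ} (α : Abelian.Ext.{u} M N j) (hk : i + j = k)
    (n e) : act α hk (mkH I M i n e) = mkH I N k n (e.comp α hk) :=
  liftH_mk _ _ _ _

lemma act_act {M N L : ModuleCat.{u} R} {i j k j' k' jj : ℕ} (α : Abelian.Ext.{u} M N j)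
    (hk : i + j = k) (β : Abelian.Ext.{u} N L j') (hk' : k + j' = k') (hj : j + j' = jj)
    (h : H I M i) : act β hk' (act α hk h) = act (α.comp β hj) (by lia) h := by
  obtain ⟨n, e, rfl⟩ := mkH_surj h
  rw [act_mk, act_mk, act_mk, Ext.comp_assoc _ _ _ _ hj (by lia)]

lemma act_id {M : ModuleCat.{u} R} {i : ℕ} (h : H I M i) :
    act (Ext.mk₀ (𝟙 M)) (add_zero i) h = h := by
  obtain ⟨n, e, rfl⟩ := mkH_surj h
  rw [act_mk, Ext.comp_mk₀_id]

lemma act_zero {M N : ModuleCat.{u} R} {i j k : ℕ} (hk : i + j = k) (h : H I M i) :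
    act (0 : Abelian.Ext.{u} M N j) hk h = 0 := by
  obtain ⟨n, e, rfl⟩ := mkH_surj h
  rw [act_mk, Ext.comp_zero, map_zero]

lemma act_add {M N : ModuleCat.{u} R} {i j k : ℕ} (α β : Abelian.Ext.{u} M N j)
    (hk : i + j = k) (h : H I M i) : act (α + β) hk h = act α hk h + act β hk h := by
  obtain ⟨n, e, rfl⟩ := mkH_surj h
  rw [act_mk, act_mk, act_mk, Ext.comp_add, map_add]

lemma act_smul {M N : ModuleCat.{u} R} {i j k : ℕ} (r : R) (α : Abelian.Ext.{u} M N j)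
    (hk : i + j = k) (h : H I M i) : act (r • α) hk h = r • act α hk h := by
  obtain ⟨n, e, rfl⟩ := mkH_surj h
  rw [act_mk, act_mk, Ext.comp_smul, map_smul]

lemma H_torsion {M : ModuleCat.{u} R} {i : ℕ} (h : H I M i) : ∃ n, ∀ r ∈ I ^ n, r • h = 0 := by
  obtain ⟨n, e, rfl⟩ := mkH_surj h
  refine ⟨n, fun r hr => ?_⟩
  have h1 : r • e = (Ext.mk₀ (r • 𝟙 (Q I n))).comp e (zero_add i) := by
    rw [Ext.mk₀_smul, Ext.smul_comp, Ext.mk₀_id_comp]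
  have h2 : r • 𝟙 (Q I n) = 0 := by
    apply ModuleCat.hom_ext
    apply Submodule.linearMap_qext
    ext
    change Submodule.Quotient.mk (r • (1 : R)) = 0
    rw [Submodule.Quotient.mk_eq_zero, smul_eq_mul, mul_one]
    exact hr
  rw [← map_smul, h1, h2, Ext.mk₀_zero, Ext.zero_comp, map_zero]

/-- evaluation at 1 -/
def ev0 (I : Ideal R) (M : ModuleCat.{u} R) : H I M 0 →ₗ[R] M :=
  liftH (fun n => 
    { toFun := fun e => (Ext.linearEquiv₀ (R := R) e).hom (Submodule.Quotient.mk 1)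
      map_add' := fun a b => by rw [map_add]; rfl
      map_smul' := fun a b => by rw [map_smul]; rfl }) (by
    intro n m h e
    obtain ⟨f, rfl⟩ := (Ext.linearEquiv₀ (R := R)).symm.surjective e
    simp only [LinearMap.coe_mk, AddHom.coe_mk, LinearEquiv.apply_symm_apply]
    rw [Ext.linearEquiv₀_symm_apply]
    change (Ext.linearEquiv₀ (R := R) ((Ext.mk₀ (tr I h)).comp (Ext.mk₀ f) _)).hom _ = _
    rw [Ext.mk₀_comp_mk₀]
    have : Ext.mk₀ (tr I h ≫ f) = (Ext.linearEquiv₀ (R := R)).symm (tr I h ≫ f) := rfl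
    rw [this, LinearEquiv.apply_symm_apply]
    rfl)

lemma ev0_inj (I : Ideal R) (M : ModuleCat.{u} R) : Function.Injective (ev0 I M) := by
  apply liftH_inj
  intro n e he
  refine ⟨n, le_refl n, ?_⟩
  rw [tr_refl, Ext.mk₀_id_comp]
  obtain ⟨f, rfl⟩ := (Ext.linearEquiv₀ (R := R)).symm.surjective e
  simp only [LinearMap.coe_mk, AddHom.coe_mk, LinearEquiv.apply_symm_apply] at he
  have : f = 0 := by
    apply ModuleCat.hom_ext
    apply Submodule.linearMap_qext
    ext
    exact he
  rw [this, map_zero]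

section LES
variable {S : ShortComplex (ModuleCat.{u} R)}

/-- functoriality -/
def mapH {M N : ModuleCat.{u} R} (f : M ⟶ N) (i : ℕ) : H I M i →ₗ[R] H I N i :=
  act (Ext.mk₀ f) (add_zero i)

/-- connecting map -/
def δH (hS : S.ShortExact) (i : ℕ) : H I S.X₃ i →ₗ[R] H I S.X₁ (i + 1) := act hS.extClass rfl

lemma mapH_comp {M N L : ModuleCat.{u} R} (f : M ⟶ N) (g : N ⟶ L) (i : ℕ) (h : H I M i) :
    mapH g i (mapH f i h) = mapH (f ≫ g) i h := by
  rw [mapH, mapH, act_act _ _ _ _ (zero_add 0), Ext.mk₀_comp_mk₀]; rfl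

lemma mapH_zero {M N : ModuleCat.{u} R} (i : ℕ) (h : H I M i) :
    mapH (0 : M ⟶ N) i h = 0 := by
  rw [mapH, Ext.mk₀_zero, act_zero]

lemma mapH_id {M : ModuleCat.{u} R} (i : ℕ) (h : H I M i) : mapH (𝟙 M) i h = h := act_id h

lemma mapH_add {M N : ModuleCat.{u} R} (f g : M ⟶ N) (i : ℕ) (h : H I M i) :
    mapH (f + g) i h = mapH f i h + mapH g i h := by
  rw [mapH, Ext.mk₀_add, act_add]; rfl

lemma mapH_smul {M N : ModuleCat.{u} R} (r : R) (f : M ⟶ N) (i : ℕ) (h : H I M i) :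
    mapH (r • f) i h = r • mapH f i h := by
  rw [mapH, Ext.mk₀_smul, act_smul]; rfl

lemma mapH_sum {M N : ModuleCat.{u} R} {ι : Type*} (s : Finset ι) (f : ι → (M ⟶ N)) (i : ℕ)
    (h : H I M i) : mapH (∑ j ∈ s, f j) i h = ∑ j ∈ s, mapH (f j) i h := by
  classical
  induction s using Finset.induction_on with
  | empty => simp [mapH_zero]
  | insert a s ha ih => rw [Finset.sum_insert ha, Finset.sum_insert ha, mapH_add, ih]

lemma mapH_δH (hS : S.ShortExact) (i : ℕ) (h : H I S.X₃ i) : mapH S.f (i+1) (δH hS i h) = 0 := by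
  rw [mapH, δH, act_act _ _ _ _ (add_zero 1), hS.extClass_comp, act_zero]

lemma δH_mapH (hS : S.ShortExact) (i : ℕ) (h : H I S.X₂ i) : δH hS i (mapH S.g i h) = 0 := by
  rw [mapH, δH, act_act _ _ _ _ (zero_add 1), hS.comp_extClass, act_zero]

lemma mapH_mapH (i : ℕ) (h : H I S.X₁ i) : mapH S.g i (mapH S.f i h) = 0 := by
  rw [mapH_comp, S.zero, mapH_zero]

lemma ex2 (hS : S.ShortExact) (i : ℕ) (h : H I S.X₂ i) (h0 : mapH S.g i h = 0) : ∃ h', mapH S.f i h' = h := by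
  obtain ⟨n, e, rfl⟩ := mkH_surj h
  rw [mapH, act_mk] at h0
  obtain ⟨m, hm, h1⟩ := mkH_eq_zero h0
  rw [← Ext.comp_assoc _ _ _ (zero_add i) _ (by lia)] at h1
  obtain ⟨e', he'⟩ := Ext.covariant_sequence_exact₂ _ hS _ h1
  exact ⟨mkH I _ i m e', by rw [mapH, act_mk, he', mkH_tr]⟩

lemma ex3 (hS : S.ShortExact) (i : ℕ) (h : H I S.X₃ i) (h0 : δH hS i h = 0) : ∃ h', mapH S.g i h' = h := by
  obtain ⟨n, e, rfl⟩ := mkH_surj h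
  rw [δH, act_mk] at h0
  obtain ⟨m, hm, h1⟩ := mkH_eq_zero h0
  rw [← Ext.comp_assoc _ _ _ (zero_add i) _ (by lia)] at h1
  obtain ⟨e', he'⟩ := Ext.covariant_sequence_exact₃ _ hS _ _ h1
  exact ⟨mkH I _ i m e', by rw [mapH, act_mk, he', mkH_tr]⟩

lemma ex1 (hS : S.ShortExact) (i : ℕ) (h : H I S.X₁ (i+1)) (h0 : mapH S.f (i+1) h = 0) : ∃ h', δH hS i h' = h := by
  obtain ⟨n, e, rfl⟩ := mkH_surj h
  rw [mapH, act_mk] at h0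
  obtain ⟨m, hm, h1⟩ := mkH_eq_zero h0
  rw [← Ext.comp_assoc _ _ _ (zero_add (i+1)) _ (by lia)] at h1
  obtain ⟨e', he'⟩ := Ext.covariant_sequence_exact₁ _ hS _ h1 rfl
  exact ⟨mkH I _ i m e', by rw [δH, act_mk, he', mkH_tr]⟩

lemma mapH_f_inj_zero (hS : S.ShortExact) (h : H I S.X₁ 0) (h0 : mapH S.f 0 h = 0) : h = 0 := by
  obtain ⟨n, e, rfl⟩ := mkH_surj h
  rw [mapH, act_mk] at h0
  obtain ⟨m, hm, h1⟩ := mkH_eq_zero h0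
  rw [← Ext.comp_assoc _ _ _ (zero_add 0) _ (by lia)] at h1
  have := hS.mono_f
  have h2 := Ext.postcomp_mk₀_injective_of_mono (Q I m) S.f
  rw [← mkH_tr hm]
  rw [injective_iff_map_eq_zero] at h2
  rw [h2 _ h1, map_zero]

lemma δH_nat {S T : ShortComplex (ModuleCat.{u} R)} (hS : S.ShortExact) (hT : T.ShortExact)
    (φ : S ⟶ T) (i : ℕ) (h : H I S.X₃ i) :
    δH hT i (mapH φ.τ₃ i h) = mapH φ.τ₁ (i+1) (δH hS i h) := by
  rw [mapH, δH, act_act _ _ _ _ (zero_add 1), mapH, δH, act_act _ _ _ _ (add_zero 1),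
    ShortComplex.ShortExact.extClass_naturality]

end LES
end HDef
end
end LC

namespace LC
open CategoryTheory Abelian Limits Opposite

noncomputable section

section Compare
variable {R : Type u} [CommRing R] (I : Ideal R)

/-- the diagram evaluated at M -/
abbrev dgM (M : ModuleCat.{u} R) (i : ℕ) : (ℕᵒᵖ)ᵒᵖ ⥤ ModuleCat.{u} R :=
  localCohomology.diagram (localCohomology.idealPowersDiagram I) i ⋙
    (evaluation _ _).obj M

/-- the colimit cocone -/
def ccM (M : ModuleCat.{u} R) (i : ℕ) : Cocone (dgM I M i) :=
  ((evaluation _ _).obj M).mapCocone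
    (colimit.cocone (localCohomology.diagram (localCohomology.idealPowersDiagram I) i))

lemma ccM_isColimit (M : ModuleCat.{u} R) (i : ℕ) : Nonempty (IsColimit (ccM I M i)) :=
  ⟨isColimitOfPreserves ((evaluation _ _).obj M) (colimit.isColimit _)⟩

/-- the structure maps, old version -/
def dIota (M : ModuleCat.{u} R) (i n : ℕ) :
    ((_root_.Ext R (ModuleCat.{u} R) i).obj (op (Q I n))).obj M →ₗ[R]
      ((localCohomology I i).obj M : ModuleCat.{u} R) :=
  ((ccM I M i).ι.app (op (op n))).hom

/-- the structure maps -/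
def ciota (M : ModuleCat.{u} R) (i n : ℕ) :
    Abelian.Ext.{u} (Q I n) M i →ₗ[R] ((localCohomology I i).obj M : ModuleCat.{u} R) :=
  (dIota I M i n).comp (oldNew (Q I n) M i).symm.toLinearMap

lemma ciota_old (M : ModuleCat.{u} R) (i n : ℕ) (e) :
    ciota I M i n (oldNew (Q I n) M i e) = dIota I M i n e := by
  simp [ciota]

lemma ciota_tr (M : ModuleCat.{u} R) (i n m : ℕ) (h : n ≤ m) (e) :
    ciota I M i m ((Ext.mk₀ (tr I h)).comp e (zero_add i)) = ciota I M i n e := by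
  obtain ⟨e, rfl⟩ := (oldNew (Q I n) M i).surjective e
  rw [← oldNew_naturality, ciota_old, ciota_old]
  have hw := (ccM I M i).w (homOfLE h).op.op
  exact LinearMap.congr_fun (ModuleCat.hom_ext_iff.1 hw) e

instance (M : ModuleCat.{u} R) (i : ℕ) : PreservesColimit (dgM I M i) (forget (ModuleCat.{u} R)) := by
  have : PreservesFilteredColimitsOfSize.{0, 0} (forget (ModuleCat.{u} R)) :=
    preservesFilteredColimitsOfSize_shrink.{0, u, 0, u} _
  infer_instance

lemma compare_bij (M : ModuleCat.{u} R) (i : ℕ) :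
    Function.Bijective (liftH (ciota I M i) (ciota_tr I M i)) := by
  obtain ⟨hc⟩ := ccM_isColimit I M i
  constructor
  · apply liftH_inj
    intro n e he
    have h0 : (ccM I M i).ι.app (op (op n)) ((oldNew (Q I n) M i).symm e) =
      (ccM I M i).ι.app (op (op n)) 0 := he.trans (map_zero _).symm
    obtain ⟨k, f, g, hfg⟩ := Concrete.isColimit_exists_of_rep_eq _ hc _ _ h0
    have hk : n ≤ k.unop.unop := leOfHom f.unop.unop
    refine ⟨k.unop.unop, hk, ?_⟩
    have h1 : ((((_root_.Ext R (ModuleCat.{u} R) i).map (tr I hk).op).app M).hom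
      ((oldNew (Q I n) M i).symm e)) = 0 := by
      refine Eq.trans ?_ (hfg.trans (map_zero _))
      rfl
    have h2 := oldNew_naturality (tr I hk) M i ((oldNew (Q I n) M i).symm e)
    rw [h1, map_zero, LinearEquiv.apply_symm_apply] at h2
    exact h2.symm
  · intro y
    obtain ⟨k, z, hz⟩ := Concrete.isColimit_exists_rep _ hc y
    refine ⟨mkH I M i k.unop.unop (oldNew (Q I k.unop.unop) M i z), ?_⟩
    rw [liftH_mk]
    exact (ciota_old I M i _ z).trans hz

/-- comparison with Mathlib local cohomology -/
def compareH (M : ModuleCat.{u} R) (i : ℕ) :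
    H I M i ≃ₗ[R] ((localCohomology I i).obj M : ModuleCat.{u} R) :=
  LinearEquiv.ofBijective _ (compare_bij I M i)

end Compare
end
end LC

namespace LC
open CategoryTheory Abelian Limits Opposite

noncomputable section

section Van
variable {R : Type u} [CommRing R] (I : Ideal R)

/-- short complex from linear maps -/
abbrev sC {A B C : Type u} [AddCommGroup A] [Module R A] [AddCommGroup B] [Module R B]
    [AddCommGroup C] [Module R C] (f : A →ₗ[R] B) (g : B →ₗ[R] C) (h : Function.Exact f g) :
    ShortComplex (ModuleCat.{u} R) :=
  ShortComplex.mk (ModuleCat.ofHom f) (ModuleCat.ofHom g)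
    (ModuleCat.hom_ext h.linearMap_comp_eq_zero)

lemma sC_se {A B C : Type u} [AddCommGroup A] [Module R A] [AddCommGroup B] [Module R B]
    [AddCommGroup C] [Module R C] (f : A →ₗ[R] B) (g : B →ₗ[R] C) (h : Function.Exact f g)
    (hf : Function.Injective f) (hg : Function.Surjective g) : (sC f g h).ShortExact where
  exact := (ShortComplex.ShortExact.moduleCat_exact_iff_function_exact _).2 h
  mono_f := (ModuleCat.mono_iff_injective _).2 hf
  epi_g := (ModuleCat.epi_iff_surjective _).2 hg

/-- morphism of short complexes from linear maps -/
abbrev sHom {A B C A' B' C' : Type u} [AddCommGroup A] [Module R A] [AddCommGroup B] [Module R B]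
    [AddCommGroup C] [Module R C] [AddCommGroup A'] [Module R A'] [AddCommGroup B'] [Module R B']
    [AddCommGroup C'] [Module R C'] {f : A →ₗ[R] B} {g : B →ₗ[R] C} {h : Function.Exact f g}
    {f' : A' →ₗ[R] B'} {g' : B' →ₗ[R] C'} {h' : Function.Exact f' g'}
    (a : A →ₗ[R] A') (b : B →ₗ[R] B') (c : C →ₗ[R] C') (h1 : ∀ x, f' (a x) = b (f x))
    (h2 : ∀ x, g' (b x) = c (g x)) : sC f g h ⟶ sC f' g' h' where
  τ₁ := ModuleCat.ofHom a
  τ₂ := ModuleCat.ofHom b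
  τ₃ := ModuleCat.ofHom c
  comm₁₂ := ModuleCat.hom_ext (LinearMap.ext h1)
  comm₂₃ := ModuleCat.hom_ext (LinearMap.ext h2)

variable {I}

lemma ext_step {F C : Type u} [AddCommGroup F] [Module R F] [AddCommGroup C] [Module R C]
    (g : F →ₗ[R] C) (hex : Function.Exact (LinearMap.ker g).subtype g)
    (hse : (sC _ _ hex).ShortExact) (N : ModuleCat.{u} R) (i : ℕ)
    (e' : Abelian.Ext.{u} (ModuleCat.of R (LinearMap.ker g)) N i)
    (Fc : Submodule R F) (Cc : Submodule R C) (hC : Cc = Submodule.map g Fc)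
    (B : Submodule R (LinearMap.ker g))
    (hB : ∀ z : LinearMap.ker g, z.1 ∈ Fc → z ∈ B)
    (hc' : (Ext.mk₀ (ModuleCat.ofHom B.subtype)).comp e' (zero_add i) = 0) :
    (Ext.mk₀ (ModuleCat.ofHom Cc.subtype)).comp (hse.extClass.comp e' (add_comm 1 i))
      (zero_add (i+1)) = 0 := by
  have hmap : ∀ x ∈ Fc, g x ∈ Cc := by
    intro x hx
    rw [hC]; exact ⟨x, hx, rfl⟩
  let g' : Fc →ₗ[R] Cc := g.restrict hmap
  have hg' : Function.Surjective g' := by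
    rintro ⟨y, hy⟩
    have hy' := hy
    rw [hC] at hy'
    obtain ⟨x, hx, rfl⟩ := hy'
    exact ⟨⟨x, hx⟩, rfl⟩
  have hex' : Function.Exact (LinearMap.ker g').subtype g' := LinearMap.exact_subtype_ker_map g'
  have hse' := sC_se _ _ hex' (Submodule.subtype_injective _) hg'
  have hmem : ∀ z : LinearMap.ker g', (z : Fc).1 ∈ LinearMap.ker g := by
    rintro ⟨z, hz⟩
    exact congrArg Subtype.val hz
  let a : LinearMap.ker g' →ₗ[R] LinearMap.ker g :=
    LinearMap.codRestrict _ (Fc.subtype.comp (Submodule.subtype _)) hmem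
  have ha : ∀ z, a z ∈ B := fun z => hB _ z.1.2
  let φ : sC _ _ hex' ⟶ sC _ _ hex := sHom (f := (LinearMap.ker g').subtype) (g := g') (h := hex')
    (f' := (LinearMap.ker g).subtype) (g' := g) (h' := hex) a Fc.subtype Cc.subtype
      (fun x => rfl) (fun x => rfl)
  have hnat := ShortComplex.ShortExact.extClass_naturality hse' hse φ
  have hfac : φ.τ₁ = ModuleCat.ofHom (a.codRestrict _ ha) ≫ ModuleCat.ofHom B.subtype := rfl
  have h1 : (Ext.mk₀ φ.τ₁).comp e' (zero_add i) = 0 := by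
    rw [hfac, ← Ext.mk₀_comp_mk₀_assoc]
    erw [hc']
    rw [Ext.comp_zero]
  have h2 : (Ext.mk₀ φ.τ₃).comp (hse.extClass.comp e' (add_comm 1 i)) (zero_add (i+1)) = 0 := by
    rw [← Ext.comp_assoc _ _ _ (zero_add 1) _ (by lia), ← hnat,
      Ext.comp_assoc _ _ _ _ (zero_add i) (by lia), h1, Ext.comp_zero]
  exact h2

lemma ext_restrict [IsNoetherianRing R] (N : ModuleCat.{u} R)
    (hN : ∀ x : N, ∃ n, ∀ r ∈ I ^ n, r • x = 0) (i : ℕ) :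
    ∀ (C : Type u) [AddCommGroup C] [Module R C] [Module.Finite R C]
      (e : Abelian.Ext.{u} (ModuleCat.of R C) N i),
      ∃ c, (Ext.mk₀ (ModuleCat.ofHom (I ^ c • ⊤ : Submodule R C).subtype)).comp e (zero_add i) = 0 := by
  induction i with
  | zero =>
    intro C _ _ _ e
    obtain ⟨f, rfl⟩ := (Ext.linearEquiv₀ (R := R)).symm.surjective e
    rw [Ext.linearEquiv₀_symm_apply]
    obtain ⟨s, hs⟩ := (Module.Finite.fg_top : (⊤ : Submodule R C).FG)
    choose n hn using hN
    refine ⟨s.sup (fun y => n (f.hom y)), ?_⟩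
    have key : ∀ r ∈ I ^ (s.sup (fun y => n (f.hom y))), ∀ y : C, r • f.hom y = 0 := by
      intro r hr y
      have hy : y ∈ Submodule.span R (s : Set C) := by rw [hs]; trivial
      induction hy using Submodule.span_induction with
      | mem y hy => exact hn _ r (Ideal.pow_le_pow_right (Finset.le_sup (f := fun y => n (f.hom y)) hy) hr)
      | zero => simp
      | add a b _ _ ha hb => rw [map_add, smul_add, ha, hb, add_zero]
      | smul a b _ hb => rw [map_smul, smul_comm, hb, smul_zero]
    erw [Ext.mk₀_comp_mk₀]
    rw [← Ext.mk₀_zero]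
    congr 1
    apply ModuleCat.hom_ext
    ext ⟨x, hx⟩
    change f.hom x = 0
    refine Submodule.smul_induction_on hx ?_ ?_
    · intro r hr y _
      rw [map_smul]; exact key r hr y
    · intro a b ha hb
      rw [map_add, ha, hb, add_zero]
  | succ i ih =>
    intro C _ _ _ e
    obtain ⟨n, g, hg⟩ := Module.Finite.exists_fin' R C
    have hex : Function.Exact (LinearMap.ker g).subtype g := LinearMap.exact_subtype_ker_map g
    have hse := sC_se _ _ hex (Submodule.subtype_injective _) hg
    have hp : Projective (ModuleCat.of R (Fin n → R)) := by
      rw [← IsProjective.iff_projective]; infer_instance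
    obtain ⟨e', he'⟩ := Ext.contravariant_sequence_exact₃ hse N e
      (Ext.eq_zero_of_projective _) (add_comm 1 i)
    obtain ⟨c', hc'⟩ := ih (LinearMap.ker g) e'
    obtain ⟨k, hk⟩ := Ideal.exists_pow_inf_eq_pow_smul I (LinearMap.ker g)
    refine ⟨k + c', ?_⟩
    rw [← he']
    refine ext_step g hex hse N i e' (I ^ (k + c') • ⊤) (I ^ (k + c') • ⊤) ?_ _ ?_ hc'
    · rw [Submodule.map_smul'', Submodule.map_top, LinearMap.range_eq_top.2 hg]
    · intro z hz
      have h1 : (z.1 : Fin n → R) ∈ I ^ c' • LinearMap.ker g := by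
        have h2 : (z.1 : Fin n → R) ∈ I ^ (k + c') • ⊤ ⊓ LinearMap.ker g := ⟨hz, z.2⟩
        rw [hk _ (Nat.le_add_right _ _), Nat.add_sub_cancel_left] at h2
        exact Submodule.smul_mono le_rfl inf_le_right h2
      have h3 : I ^ c' • LinearMap.ker g =
        Submodule.map (LinearMap.ker g).subtype (I ^ c' • ⊤) := by
        rw [Submodule.map_smul'', Submodule.map_top, Submodule.range_subtype]
      rw [h3] at h1
      obtain ⟨w, hw, hw'⟩ := h1
      have : w = z := Subtype.ext hw'
      rw [← this]; exact hw

lemma H_van [IsNoetherianRing R] (N : ModuleCat.{u} R)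
    (hN : ∀ x : N, ∃ n, ∀ r ∈ I ^ n, r • x = 0) (i : ℕ) (h : H I N (i+1)) : h = 0 := by
  obtain ⟨n, e, rfl⟩ := mkH_surj h
  have hex : ∀ n, Function.Exact (I ^ n : Ideal R).subtype (Submodule.mkQ (I ^ n)) :=
    fun n => LinearMap.exact_subtype_mkQ _
  have hse : ∀ n, (sC _ _ (hex n)).ShortExact := 
    fun n => sC_se _ _ (hex n) (Submodule.subtype_injective _) (Submodule.mkQ_surjective _)
  have hp : Projective (ModuleCat.of R R) := by
    rw [← IsProjective.iff_projective]; infer_instance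
  obtain ⟨e', he'⟩ := Ext.contravariant_sequence_exact₃ (hse n) N e
      (Ext.eq_zero_of_projective _) (add_comm 1 i)
  obtain ⟨c, hc⟩ := ext_restrict N hN i (I ^ n : Ideal R) e'
  let a : (I ^ (n + c) : Ideal R) →ₗ[R] (I ^ n : Ideal R) :=
    Submodule.inclusion (Ideal.pow_le_pow_right (Nat.le_add_right _ _))
  have ha : ∀ z, a z ∈ (I ^ c • ⊤ : Submodule R (I ^ n : Ideal R)) := by
    intro z
    have h1 : (z.1 : R) ∈ Submodule.map (I ^ n : Ideal R).subtype (I ^ c • ⊤) := by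
      rw [Submodule.map_smul'', Submodule.map_top, Submodule.range_subtype, smul_eq_mul,
        ← pow_add, add_comm]
      exact z.2
    obtain ⟨w, hw, hw'⟩ := h1
    have : w = a z := Subtype.ext hw'
    rw [← this]; exact hw
  let φ : sC _ _ (hex (n + c)) ⟶ sC _ _ (hex n) := sHom a LinearMap.id
    (tr I (Nat.le_add_right n c)).hom (fun x => rfl) (fun x => rfl)
  have hnat := ShortComplex.ShortExact.extClass_naturality (hse (n+c)) (hse n) φ
  have hfac : φ.τ₁ = ModuleCat.ofHom (a.codRestrict _ ha) ≫
      ModuleCat.ofHom (I ^ c • ⊤ : Submodule R (I ^ n : Ideal R)).subtype := rfl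
  have h1 : (Ext.mk₀ φ.τ₁).comp e' (zero_add i) = 0 := by
    rw [hfac, ← Ext.mk₀_comp_mk₀_assoc]
    erw [hc]
    rw [Ext.comp_zero]
  have h2 : (Ext.mk₀ φ.τ₃).comp ((hse n).extClass.comp e' (add_comm 1 i)) (zero_add (i+1)) = 0 := by
    rw [← Ext.comp_assoc _ _ _ (zero_add 1) _ (by lia), ← hnat,
      Ext.comp_assoc _ _ _ _ (zero_add i) (by lia), h1, Ext.comp_zero]
  rw [he'] at h2
  rw [← mkH_tr (Nat.le_add_right n c)]
  erw [h2]
  rw [map_zero]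

end Van
end
end LC

namespace LC
open CategoryTheory Abelian Limits Opposite

noncomputable section

section API
variable {R : Type u} [CommRing R] (I : Ideal R)

/-- unbundled local cohomology -/
def HH (M : Type u) [AddCommGroup M] [Module R M] (i : ℕ) : Type u := H I (ModuleCat.of R M) i

instance (M : Type u) [AddCommGroup M] [Module R M] (i : ℕ) : AddCommGroup (HH I M i) :=
  inferInstanceAs (AddCommGroup (H I (ModuleCat.of R M) i))

instance (M : Type u) [AddCommGroup M] [Module R M] (i : ℕ) : Module R (HH I M i) :=
  inferInstanceAs (Module R (H I (ModuleCat.of R M) i))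

variable {I}
variable {A B C : Type u} [AddCommGroup A] [Module R A] [AddCommGroup B] [Module R B]
  [AddCommGroup C] [Module R C]

/-- functoriality -/
def mL (f : A →ₗ[R] B) (i : ℕ) : HH I A i →ₗ[R] HH I B i := mapH (ModuleCat.ofHom f) i

/-- connecting map -/
def dL {f : A →ₗ[R] B} {g : B →ₗ[R] C} (h : Function.Exact f g) (hf : Function.Injective f)
    (hg : Function.Surjective g) (i : ℕ) : HH I C i →ₗ[R] HH I A (i + 1) :=
  δH (sC_se f g h hf hg) i

lemma mL_comp (f : A →ₗ[R] B) (g : B →ₗ[R] C) (i : ℕ) (h : HH I A i) :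
    mL g i (mL f i h) = mL (g.comp f) i h :=
  mapH_comp (ModuleCat.ofHom f) (ModuleCat.ofHom g) i h

lemma mL_id (i : ℕ) (h : HH I A i) : mL (LinearMap.id : A →ₗ[R] A) i h = h := mapH_id i h

lemma mL_zero (i : ℕ) (h : HH I A i) : mL (0 : A →ₗ[R] B) i h = 0 := mapH_zero i h

lemma mL_smul (r : R) (f : A →ₗ[R] B) (i : ℕ) (h : HH I A i) :
    mL (r • f) i h = r • mL f i h := mapH_smul r (ModuleCat.ofHom f) i h

lemma mL_add (f g : A →ₗ[R] B) (i : ℕ) (h : HH I A i) :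
    mL (f + g) i h = mL f i h + mL g i h := mapH_add (ModuleCat.ofHom f) (ModuleCat.ofHom g) i h

lemma mL_sum {ι : Type*} (s : Finset ι) (f : ι → A →ₗ[R] B) (i : ℕ) (h : HH I A i) :
    mL (∑ j ∈ s, f j) i h = ∑ j ∈ s, mL (f j) i h := by
  classical
  induction s using Finset.induction_on with
  | empty => simp [mL_zero]
  | insert a s ha ih => rw [Finset.sum_insert ha, Finset.sum_insert ha, mL_add, ih]

lemma HH_torsion {i : ℕ} (h : HH I A i) : ∃ n, ∀ r ∈ I ^ n, r • h = 0 := H_torsion h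

variable (I A) in
/-- evaluation in degree zero -/
def e0 : HH I A 0 →ₗ[R] A := ev0 I (ModuleCat.of R A)

variable (I A) in
lemma e0_inj : Function.Injective (e0 I A) := ev0_inj I _

lemma HH_van [IsNoetherianRing R]
    (hN : ∀ x : A, ∃ n, ∀ r ∈ I ^ n, r • x = 0) (i : ℕ) (h : HH I A (i+1)) : h = 0 :=
  H_van (ModuleCat.of R A) hN i h

section les
variable {f : A →ₗ[R] B} {g : B →ₗ[R] C} (h : Function.Exact f g) (hf : Function.Injective f)
    (hg : Function.Surjective g)

lemma mL_dL (i : ℕ) (c : HH I C i) : mL f (i+1) (dL h hf hg i c) = 0 :=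
  mapH_δH (sC_se f g h hf hg) i c

lemma dL_mL (i : ℕ) (b : HH I B i) : dL h hf hg i (mL g i b) = 0 :=
  δH_mapH (sC_se f g h hf hg) i b


lemma exB {f : A →ₗ[R] B} {g : B →ₗ[R] C} (h : Function.Exact f g) (hf : Function.Injective f)
    (hg : Function.Surjective g) (i : ℕ) (b : HH I B i) (h0 : mL g i b = 0) : ∃ a, mL f i a = b :=
  ex2 (sC_se f g h hf hg) i b h0

lemma exC (i : ℕ) (c : HH I C i) (h0 : dL h hf hg i c = 0) : ∃ b, mL g i b = c :=
  ex3 (sC_se f g h hf hg) i c h0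

lemma exA (i : ℕ) (a : HH I A (i+1)) (h0 : mL f (i+1) a = 0) : ∃ c, dL h hf hg i c = a :=
  ex1 (sC_se f g h hf hg) i a h0

variable {A' B' C' : Type u} [AddCommGroup A'] [Module R A'] [AddCommGroup B'] [Module R B']
  [AddCommGroup C'] [Module R C'] {f' : A' →ₗ[R] B'} {g' : B' →ₗ[R] C'}
  (h' : Function.Exact f' g') (hf' : Function.Injective f') (hg' : Function.Surjective g')

lemma dL_nat (a : A →ₗ[R] A') (b : B →ₗ[R] B') (c : C →ₗ[R] C') (h1 : ∀ x, f' (a x) = b (f x))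
    (h2 : ∀ x, g' (b x) = c (g x)) (i : ℕ) (z : HH I C i) :
    dL h' hf' hg' i (mL c i z) = mL a (i+1) (dL h hf hg i z) :=
  δH_nat (sC_se f g h hf hg) (sC_se f' g' h' hf' hg')
    (sHom (f := f) (g := g) (h := h) (f' := f') (g' := g') (h' := h') a b c h1 h2) i z

end les

/-- degree zero left exactness -/
lemma mL_inj0 {f : A →ₗ[R] B} (hf : Function.Injective f) (a : HH I A 0) (h0 : mL f 0 a = 0) :
    a = 0 :=
  mapH_f_inj_zero (sC_se f _ (LinearMap.exact_map_mkQ_range f) hf (Submodule.mkQ_surjective _)) a h0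

end API
end
end LC

namespace LC

noncomputable section

section CA
variable {R : Type u} [CommRing R]

lemma ann_quot_le {M : Type u} [AddCommGroup M] [Module R M] [Module.Finite R M] (J p : Ideal R)
    [hp : p.IsPrime] : Module.annihilator R (M ⧸ (J • ⊤ : Submodule R M)) ≤ p ↔
      J ≤ p ∧ Module.annihilator R M ≤ p := by
  have h := Module.support_quotient (R := R) (M := M) J
  rw [Module.support_eq_zeroLocus, Module.support_eq_zeroLocus] at h
  have h2 := Set.ext_iff.1 h ⟨p, hp⟩
  simp only [Set.mem_inter_iff, PrimeSpectrum.mem_zeroLocus, SetLike.coe_subset_coe] at h2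
  rw [h2, and_comm]

variable [IsLocalRing R]

/-- `q` is a parameter-like ideal of `M`: `M/qM` is supported only at the maximal ideal. -/
def Par (M : Type u) [AddCommGroup M] [Module R M] (q : Ideal R) : Prop :=
  ∀ p : Ideal R, p.IsPrime → q ≤ p → Module.annihilator R M ≤ p → maximalIdeal R ≤ p

lemma par_quot {M : Type u} [AddCommGroup M] [Module R M] [Module.Finite R M] (J q : Ideal R) :
    Par (M ⧸ (J • ⊤ : Submodule R M)) q ↔ Par M (J ⊔ q) := by
  constructor
  · intro h p hp h1 h2
    exact h p hp (le_sup_right.trans h1) ((ann_quot_le J p).2 ⟨le_sup_left.trans h1, h2⟩)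
  · intro h p hp h1 h2
    rw [ann_quot_le] at h2
    exact h p hp (sup_le h2.1 h1) h2.2

lemma par_tors [IsNoetherianRing R] {M : Type u} [AddCommGroup M] [Module R M] (h : Par (R := R) M ⊥) :
    ∃ n, ∀ r ∈ maximalIdeal R ^ n, ∀ x : M, r • x = 0 := by
  have : maximalIdeal R ≤ (Module.annihilator R M).radical := by
    rw [Ideal.radical_eq_sInf]
    exact le_sInf fun p hp => h p hp.2 bot_le hp.1
  obtain ⟨n, hn⟩ := Ideal.exists_pow_le_of_le_radical_of_fg this (IsNoetherian.noetherian _)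
  exact ⟨n, fun r hr x => Module.mem_annihilator.1 (hn hr) x⟩

lemma fl_pow {M : Type u} [AddCommGroup M] [Module R M] (h : IsFiniteLength R M) :
    ∃ n, maximalIdeal R ^ n ≤ Module.annihilator R M := by
  induction h with
  | of_subsingleton =>
    exact ⟨0, fun r _ => Module.mem_annihilator.2 fun m => Subsingleton.elim _ _⟩
  | @of_simple_quotient M _ _ N hs h ih =>
    obtain ⟨n, hn⟩ := ih
    refine ⟨n + 1, ?_⟩
    rw [pow_succ, Ideal.mul_le]
    intro r hr s hs
    rw [Module.mem_annihilator]
    intro m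
    have hm : (Module.annihilator R (M ⧸ N)) = maximalIdeal R :=
      IsLocalRing.eq_maximalIdeal IsSimpleModule.annihilator_isMaximal
    rw [← hm] at hs
    have h1 := Module.mem_annihilator.1 hs (Submodule.Quotient.mk m)
    rw [← Submodule.Quotient.mk_smul, Submodule.Quotient.mk_eq_zero] at h1
    have h2 := Module.mem_annihilator.1 (hn hr) ⟨_, h1⟩
    rw [mul_smul]
    exact congrArg Subtype.val h2

lemma par_bot_iff [IsNoetherianRing R] {M : Type u} [AddCommGroup M] [Module R M] [Module.Finite R M] :
    Par (R := R) M ⊥ ↔ IsFiniteLength R M := by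
  constructor
  · intro h
    rw [isFiniteLength_iff_isNoetherian_isArtinian]
    refine ⟨inferInstance, ?_⟩
    letI := Module.quotientAnnihilator (R := R) (M := M)
    have hA : IsArtinianRing (R ⧸ Module.annihilator R M) := by
      rw [isArtinianRing_iff_isNoetherianRing_krullDimLE_zero, Ring.krullDimLE_zero_iff]
      refine ⟨inferInstance, fun p hp => ?_⟩
      have h1 : maximalIdeal R ≤ p.comap (Ideal.Quotient.mk _) := by
        apply h _ inferInstance bot_le
        intro r hr
        rw [Ideal.mem_comap, Ideal.Quotient.eq_zero_iff_mem.2 hr]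
        exact p.zero_mem
      have h2 : (p.comap (Ideal.Quotient.mk (Module.annihilator R M))).IsMaximal := by
        have : p.comap (Ideal.Quotient.mk (Module.annihilator R M)) = maximalIdeal R :=
          le_antisymm (IsLocalRing.le_maximalIdeal (Ideal.IsPrime.ne_top inferInstance)) h1
        rw [this]; infer_instance
      exact Ideal.isMaximal_of_isIntegral_of_isMaximal_comap' _ (RingHom.isIntegral_of_surjective _ Ideal.Quotient.mk_surjective) p h2
    have hT : IsScalarTower R (R ⧸ Module.annihilator R M) M := ⟨fun r s m => by
      obtain ⟨s, rfl⟩ := Ideal.Quotient.mk_surjective s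
      rw [← Ideal.Quotient.mk_eq_mk, ← Submodule.Quotient.mk_smul]
      exact mul_smul r s m⟩
    have : Module.Finite (R ⧸ Module.annihilator R M) M :=
      Module.Finite.of_restrictScalars_finite R _ M
    have : IsArtinian (R ⧸ Module.annihilator R M) M := inferInstance
    exact isArtinian_of_surjective_algebraMap (R := R ⧸ Module.annihilator R M)
      Ideal.Quotient.mk_surjective
  · intro h p hp _ h2
    obtain ⟨n, hn⟩ := fl_pow h
    exact hp.le_of_pow_le (hn.trans h2)

lemma isSOP_iff [IsNoetherianRing R] {M : Type u} [AddCommGroup M] [Module R M] [Module.Finite R M]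
    {d : ℕ} {x : Fin d → R} : IsSOP R M d x ↔
      (∀ i, x i ∈ maximalIdeal R) ∧ Par M (Ideal.span (Set.range x)) := by
  unfold IsSOP
  rw [← par_bot_iff, par_quot, sup_bot_eq]

lemma mem_bIdeal {M : Type u} [AddCommGroup M] [Module R M] {d : ℕ} {a : R} :
    a ∈ bIdeal R M d ↔ ∀ y : Fin d → R, IsSOP R M d y → ∀ i : Fin d, ∀ v : M,
      y i • v ∈ (Ideal.span (y '' {j | j < i}) • ⊤ : Submodule R M) →
      a • v ∈ (Ideal.span (y '' {j | j < i}) • ⊤ : Submodule R M) := by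
  unfold bIdeal
  simp only [Ideal.mem_iInf, Module.mem_annihilator]
  constructor
  · intro h y hy i v hv
    have h1 : (Submodule.Quotient.mk v : M ⧸ (Ideal.span (y '' {j | j < i}) • ⊤ : Submodule R M)) ∈
      Submodule.torsionBy R _ (y i) := by
      rw [Submodule.mem_torsionBy_iff, ← Submodule.Quotient.mk_smul, Submodule.Quotient.mk_eq_zero]
      exact hv
    have h2 := congrArg Subtype.val (h y hy i ⟨_, h1⟩)
    have h3 : a • (Submodule.Quotient.mk v : M ⧸ (Ideal.span (y '' {j | j < i}) • ⊤ : Submodule R M)) = 0 := h2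
    rwa [← Submodule.Quotient.mk_smul, Submodule.Quotient.mk_eq_zero] at h3
  · rintro h y hy i ⟨v, hv⟩
    obtain ⟨v, rfl⟩ := Submodule.Quotient.mk_surjective _ v
    rw [Submodule.mem_torsionBy_iff, ← Submodule.Quotient.mk_smul, Submodule.Quotient.mk_eq_zero] at hv
    apply Subtype.ext
    change a • (Submodule.Quotient.mk v : M ⧸ (Ideal.span (y '' {j | j < i}) • ⊤ : Submodule R M)) = 0
    rw [← Submodule.Quotient.mk_smul, Submodule.Quotient.mk_eq_zero]
    exact h y hy i v hv

end CA
end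
end LC

namespace LC

noncomputable section

section CA2
variable {R : Type u} [CommRing R]

lemma coset_avoid_aux (A B : Finset (Ideal R)) (hA : ∀ p ∈ A, p.IsPrime)
    (hAB : ∀ p ∈ A, ∀ q ∈ B, ¬ q ≤ p) (J : Ideal R)
    (h : ∀ p ∈ A, ¬ J ≤ p) : ∃ z ∈ J * B.inf id, ∀ p ∈ A, z ∉ p := by
  by_contra! hcon
  have h1 : ((J * B.inf id : Ideal R) : Set R) ⊆ ⋃ p ∈ (A : Set (Ideal R)), (id p : Ideal R) := by
    intro z hz
    obtain ⟨p, hp, hzp⟩ := hcon z hz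
    exact Set.mem_biUnion hp hzp
  obtain ⟨p, hp, hle⟩ := (Ideal.subset_union_prime (f := id) ⊥ ⊥ (fun p hp _ _ => hA p hp)).1 h1
  rcases (hA p hp).mul_le.1 hle with h2 | h2
  · exact h p hp h2
  · obtain ⟨q, hq, hqp⟩ := ((hA p hp).inf_le').1 h2
    exact hAB p hp q hq hqp

lemma coset_avoid (s : Finset (Ideal R)) (hs : ∀ p ∈ s, p.IsPrime) (y : R) (J : Ideal R)
    (h : ∀ p ∈ s, y ∈ p → ¬ J ≤ p) : ∃ z ∈ J, ∀ p ∈ s, y + z ∉ p := by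
  classical
  obtain ⟨A, hA⟩ : ∃ A : Finset (Ideal R), ∀ p, p ∈ A ↔ Maximal (· ∈ s) p ∧ y ∈ p :=
    ⟨s.filter (fun p => Maximal (· ∈ s) p ∧ y ∈ p), fun p => by
      rw [Finset.mem_filter]; exact ⟨fun h => h.2, fun h => ⟨h.1.prop, h⟩⟩⟩
  obtain ⟨B, hB⟩ : ∃ B : Finset (Ideal R), ∀ p, p ∈ B ↔ Maximal (· ∈ s) p ∧ y ∉ p :=
    ⟨s.filter (fun p => Maximal (· ∈ s) p ∧ y ∉ p), fun p => by
      rw [Finset.mem_filter]; exact ⟨fun h => h.2, fun h => ⟨h.1.prop, h⟩⟩⟩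
  obtain ⟨z, hz, hzA⟩ := coset_avoid_aux A B (fun p hp => hs p ((hA p).1 hp).1.prop)
    (fun p hp q hq hqp => by
      have h1 := (hA p).1 hp
      have h2 := (hB q).1 hq
      have h3 : q = p := h2.1.eq_of_le h1.1.prop hqp
      rw [h3] at h2
      exact h2.2 h1.2) J (fun p hp => h p ((hA p).1 hp).1.prop ((hA p).1 hp).2)
  have hz2 : z ∈ J ⊓ B.inf id := Ideal.mul_le_inf hz
  refine ⟨z, hz2.1, fun p hp hyz => ?_⟩
  obtain ⟨q, hpq, hq⟩ := Finset.exists_le_maximal s hp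
  have hyzq := hpq hyz
  by_cases hy : y ∈ q
  · exact hzA q ((hA q).2 ⟨hq, hy⟩) ((Ideal.add_mem_iff_right _ hy).1 hyzq)
  · have hzq : z ∈ q := by
      have h1 : z ∈ B.inf id := hz2.2
      exact (Finset.inf_le (f := id) ((hB q).2 ⟨hq, hy⟩)) h1
    exact hy ((Ideal.add_mem_iff_left _ hzq).1 hyzq)

lemma mk_mem_smul {M : Type u} [AddCommGroup M] [Module R M] (I J : Ideal R) (v : M) :
    (Submodule.Quotient.mk v : M ⧸ (I • ⊤ : Submodule R M)) ∈ (J • ⊤ : Submodule R (M ⧸ (I • ⊤ : Submodule R M))) ↔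
      v ∈ ((I ⊔ J) • ⊤ : Submodule R M) := by
  have h1 : (J • ⊤ : Submodule R (M ⧸ (I • ⊤ : Submodule R M))) =
      Submodule.map (I • ⊤ : Submodule R M).mkQ (J • ⊤) := by
    rw [Submodule.map_smul'', Submodule.map_top, Submodule.range_mkQ]
  rw [h1, Submodule.sup_smul]
  have h2 : (I • ⊤ : Submodule R M) ⊔ J • ⊤ =
    Submodule.comap (I • ⊤ : Submodule R M).mkQ (Submodule.map (I • ⊤ : Submodule R M).mkQ (J • ⊤)) := by
    rw [Submodule.comap_map_mkQ]
  rw [h2]; rfl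

/-- iterated quotient -/
def qq (M : Type u) [AddCommGroup M] [Module R M] (I J : Ideal R) :
    ((M ⧸ (I • ⊤ : Submodule R M)) ⧸ (J • ⊤ : Submodule R (M ⧸ (I • ⊤ : Submodule R M)))) ≃ₗ[R]
      M ⧸ ((I ⊔ J) • ⊤ : Submodule R M) :=
  (Submodule.quotEquivOfEq _ _ (by
    rw [Submodule.map_smul'', Submodule.map_top, Submodule.range_mkQ])).trans
  ((Submodule.quotientQuotientEquivQuotientSup (I • ⊤ : Submodule R M) (J • ⊤)).trans
  (Submodule.quotEquivOfEq _ _ (Submodule.sup_smul _ _ _).symm))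

lemma equiv_mem_smul {M N : Type u} [AddCommGroup M] [Module R M] [AddCommGroup N] [Module R N]
    (e : M ≃ₗ[R] N) (J : Ideal R) (v : M) :
    e v ∈ (J • ⊤ : Submodule R N) ↔ v ∈ (J • ⊤ : Submodule R M) := by
  have h1 : (J • ⊤ : Submodule R N) = Submodule.map e.toLinearMap (J • ⊤) := by
    rw [Submodule.map_smul'', Submodule.map_top, LinearEquiv.range]
  rw [h1]
  constructor
  · rintro ⟨w, hw, hwv⟩
    rwa [← e.injective hwv]
  · intro h
    exact ⟨v, h, rfl⟩

variable [IsLocalRing R]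

lemma isSOP_equiv {M N : Type u} [AddCommGroup M] [Module R M] [AddCommGroup N] [Module R N]
    (e : M ≃ₗ[R] N) {d : ℕ} {x : Fin d → R} (h : IsSOP R M d x) : IsSOP R N d x := by
  refine ⟨h.1, (Submodule.Quotient.equiv _ _ e ?_).isFiniteLength h.2⟩
  change Submodule.map e.toLinearMap _ = _
  rw [Submodule.map_smul'', Submodule.map_top, LinearEquiv.range]

lemma bIdeal_le_equiv {M N : Type u} [AddCommGroup M] [Module R M] [AddCommGroup N] [Module R N]
    (e : M ≃ₗ[R] N) (d : ℕ) : bIdeal R M d ≤ bIdeal R N d := by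
  intro a ha
  rw [mem_bIdeal] at ha ⊢
  intro y hy i v hv
  have := ha y (isSOP_equiv e.symm hy) i (e.symm v)
  rw [← map_smul, ← map_smul, equiv_mem_smul, equiv_mem_smul] at this
  exact this hv

lemma bIdeal_equiv {M N : Type u} [AddCommGroup M] [Module R M] [AddCommGroup N] [Module R N]
    (e : M ≃ₗ[R] N) (d : ℕ) : bIdeal R M d = bIdeal R N d :=
  le_antisymm (bIdeal_le_equiv e d) (bIdeal_le_equiv e.symm d)

lemma span_range_cons {d : ℕ} (x : R) (y : Fin d → R) :
    Ideal.span (Set.range (Fin.cons x y : Fin (d+1) → R)) =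
      Ideal.span {x} ⊔ Ideal.span (Set.range y) := by
  rw [Fin.range_cons, Ideal.span_insert]

lemma cons_image {d : ℕ} (x : R) (y : Fin d → R) (i : Fin d) :
    Ideal.span ((Fin.cons x y : Fin (d+1) → R) '' {j | j < i.succ}) =
      Ideal.span {x} ⊔ Ideal.span (y '' {j | j < i}) := by
  rw [← Ideal.span_union]
  congr 1
  ext r
  simp only [Set.mem_image, Set.mem_ofPred_eq, Set.mem_union, Set.mem_singleton_iff]
  rw [Fin.exists_fin_succ]
  simp only [Fin.cons_zero, Fin.cons_succ, Fin.succ_lt_succ_iff, Fin.succ_pos, true_and]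
  rw [eq_comm]

variable [IsNoetherianRing R]

lemma isSOP_cons {M : Type u} [AddCommGroup M] [Module R M] [Module.Finite R M] {d : ℕ} {x : R}
    (hx : x ∈ maximalIdeal R) {y : Fin d → R} (hy : IsSOP R (M ⧸ (Ideal.span {x} • ⊤ : Submodule R M)) d y) :
    IsSOP R M (d+1) (Fin.cons x y) := by
  rw [isSOP_iff] at hy ⊢
  refine ⟨fun i => ?_, ?_⟩
  · refine Fin.cases ?_ (fun j => ?_) i
    · simpa using hx
    · simpa using hy.1 j
  · rw [span_range_cons]
    exact (par_quot _ _).1 hy.2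

lemma bIdeal_quot {M : Type u} [AddCommGroup M] [Module R M] [Module.Finite R M] {d : ℕ} {x : R}
    (hx : x ∈ maximalIdeal R) :
    bIdeal R M (d+1) ≤ bIdeal R (M ⧸ (Ideal.span {x} • ⊤ : Submodule R M)) d := by
  intro a ha
  rw [mem_bIdeal] at ha ⊢
  intro y hy i v hv
  obtain ⟨v, rfl⟩ := Submodule.Quotient.mk_surjective _ v
  have h1 := ha _ (isSOP_cons hx hy) i.succ v
  rw [cons_image] at h1
  rw [← Submodule.Quotient.mk_smul, mk_mem_smul] at hv ⊢
  exact h1 hv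

/-- the first element of a system of parameters -/
lemma bIdeal_first {M : Type u} [AddCommGroup M] [Module R M] [Module.Finite R M] {d : ℕ} {x : R}
    {y : Fin d → R} (h : IsSOP R M (d+1) (Fin.cons x y)) {a : R} (ha : a ∈ bIdeal R M (d+1))
    {v : M} (hv : x • v = 0) : a • v = 0 := by
  rw [mem_bIdeal] at ha
  have h1 := ha _ h 0 v
  have h2 : {j : Fin (d+1) | j < 0} = ∅ := by ext j; simp
  rw [h2, Set.image_empty, Ideal.span_empty, Submodule.bot_smul] at h1
  simpa [hv] using h1

lemma exists_param {M : Type u} [AddCommGroup M] [Module R M] [Module.Finite R M] {d : ℕ}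
    {y : Fin (d+1) → R} (hy : IsSOP R M (d+1) y) :
    ∃ x ∈ maximalIdeal R, (∀ n, IsSOP R M (d+1) (Fin.cons (x ^ (n+1)) (Fin.tail y))) ∧
      ∀ p ∈ associatedPrimes R M, p ≠ maximalIdeal R → x ∉ p := by
  classical
  rw [isSOP_iff] at hy
  have hfin := associatedPrimes.finite R M
  have hspan : Ideal.span (Set.range y) = Ideal.span {y 0} ⊔ Ideal.span (Set.range (Fin.tail y)) := by
    rw [← span_range_cons, Fin.cons_self_tail]
  obtain ⟨z, hz, hzp⟩ := coset_avoid (hfin.toFinset.filter (· ≠ maximalIdeal R))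
    (fun p hp => by
      have := (Finset.mem_filter.1 hp).1
      rw [Set.Finite.mem_toFinset] at this
      exact this.isPrime) (y 0) (Ideal.span (Set.range (Fin.tail y))) (by
      intro p hp h1 h2
      have h3 := (Finset.mem_filter.1 hp).1
      rw [Set.Finite.mem_toFinset] at h3
      have h3 : IsAssociatedPrime p M := h3
      have hpp := h3.isPrime
      apply (Finset.mem_filter.1 hp).2
      refine le_antisymm (IsLocalRing.le_maximalIdeal hpp.ne_top) (hy.2 p hpp ?_
        (Submodule.annihilator_top (R := R) (M := M) ▸ h3.annihilator_le))
      rw [hspan, sup_le_iff, Ideal.span_singleton_le_iff_mem]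
      exact ⟨h1, h2⟩)
  have htail : Ideal.span (Set.range (Fin.tail y)) ≤ maximalIdeal R := by
    rw [Ideal.span_le]
    rintro _ ⟨j, rfl⟩
    exact hy.1 _
  have hxm : y 0 + z ∈ maximalIdeal R := Ideal.add_mem _ (hy.1 0) (htail hz)
  refine ⟨y 0 + z, hxm, fun n => ?_, fun p hp hpm => hzp p (Finset.mem_filter.2 ⟨hfin.mem_toFinset.2 hp, hpm⟩)⟩
  rw [isSOP_iff]
  refine ⟨fun i => ?_, fun p hp h1 h2 => hy.2 p hp ?_ h2⟩
  · refine Fin.cases ?_ (fun j => ?_) i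
    · simpa using Ideal.pow_mem_of_mem _ hxm _ (Nat.succ_pos n)
    · rw [Fin.cons_succ]; exact hy.1 j.succ
  · rw [span_range_cons, sup_le_iff, Ideal.span_singleton_le_iff_mem] at h1
    rw [hspan, sup_le_iff, Ideal.span_singleton_le_iff_mem]
    refine ⟨?_, h1.2⟩
    have := hp.mem_of_pow_mem _ h1.1
    exact (Ideal.add_mem_iff_left _ (h1.2 hz)).1 this

/-- kernels of such elements have support in the maximal ideal -/
lemma par_ker {M : Type u} [AddCommGroup M] [Module R M] [Module.Finite R M] {x : R} (n : ℕ)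
    (h : ∀ p ∈ associatedPrimes R M, p ≠ maximalIdeal R → x ∉ p) (K : Submodule R M)
    (hK : ∀ v ∈ K, x ^ n • v = 0) : Par (R := R) K ⊥ := by
  intro p hp _ h2
  obtain ⟨q, hq, hqp⟩ := Ideal.exists_minimalPrimes_le h2
  have h3 := Module.associatedPrimes.minimalPrimes_annihilator_subset_associatedPrimes R K hq
  have h4 := associatedPrimes.subset_of_injective K.subtype_injective h3
  have h5 : x ∈ q := by
    refine hq.1.1.mem_of_pow_mem n (hq.1.2 (Module.mem_annihilator.2 fun v => ?_))
    exact Subtype.ext (hK v.1 v.2)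
  by_cases h6 : q = maximalIdeal R
  · exact h6 ▸ hqp
  · exact absurd h5 (h q h4 h6)

end CA2
end
end LC

namespace LC

noncomputable section

section Van2
variable {R : Type u} [CommRing R]

section mulBar
variable {M : Type u} [AddCommGroup M] [Module R M]

/-- multiplication by `r`, factored through the quotient by a submodule killed by `r` -/
def mB (K : Submodule R M) (r : R) (h : ∀ v ∈ K, r • v = 0) : (M ⧸ K) →ₗ[R] M :=
  K.liftQ (LinearMap.lsmul R M r) h

@[simp] lemma mB_mk (K : Submodule R M) (r : R) (h : ∀ v ∈ K, r • v = 0) (v : M) :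
    mB K r h (Submodule.Quotient.mk v) = r • v := rfl

lemma mem_span_smul {r : R} {w : M} :
    w ∈ (Ideal.span {r} • ⊤ : Submodule R M) ↔ ∃ v, r • v = w := by
  rw [Submodule.ideal_span_singleton_smul, Submodule.mem_smul_pointwise_iff_exists]
  simp

lemma mB_exact (K : Submodule R M) (r : R) (h : ∀ v ∈ K, r • v = 0) :
    Function.Exact (mB K r h) (Ideal.span {r} • ⊤ : Submodule R M).mkQ := by
  intro w
  rw [Submodule.mkQ_apply, Submodule.Quotient.mk_eq_zero, mem_span_smul]
  constructor
  · rintro ⟨v, rfl⟩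
    exact ⟨Submodule.Quotient.mk v, rfl⟩
  · rintro ⟨v, rfl⟩
    obtain ⟨v, rfl⟩ := Submodule.Quotient.mk_surjective _ v
    exact ⟨v, rfl⟩

lemma mB_inj (K : Submodule R M) (r : R) (h : ∀ v ∈ K, r • v = 0) (h' : ∀ v, r • v = 0 → v ∈ K) :
    Function.Injective (mB K r h) := by
  rw [injective_iff_map_eq_zero]
  intro v hv
  obtain ⟨v, rfl⟩ := Submodule.Quotient.mk_surjective _ v
  rw [Submodule.Quotient.mk_eq_zero]
  exact h' v hv

variable {I : Ideal R}

lemma mB_mkQ (K : Submodule R M) (r : R) (h : ∀ v ∈ K, r • v = 0) (i : ℕ) (z : HH I M i) :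
    mL (mB K r h) i (mL K.mkQ i z) = r • z := by
  rw [mL_comp]
  have : (mB K r h).comp K.mkQ = r • LinearMap.id := rfl
  rw [this, mL_smul, mL_id]

lemma mkQ_mB (K : Submodule R M) (r : R) (h : ∀ v ∈ K, r • v = 0) (i : ℕ) (z : HH I (M ⧸ K) i) :
    mL K.mkQ i (mL (mB K r h) i z) = r • z := by
  rw [mL_comp]
  have : K.mkQ.comp (mB K r h) = r • LinearMap.id := by
    apply Submodule.linearMap_qext
    rfl
  rw [this, mL_smul, mL_id]

lemma mkQ_inj (K : Submodule R M) (i : ℕ) (hK : ∀ z : HH I K i, z = 0) (z : HH I M i)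
    (hz : mL K.mkQ i z = 0) : z = 0 := by
  obtain ⟨a, rfl⟩ := exB (LinearMap.exact_subtype_mkQ K) K.subtype_injective
    K.mkQ_surjective i z hz
  rw [hK a, map_zero]

end mulBar

lemma chase {M : Type u} [AddCommGroup M] [Module R M] {I : Ideal R} (r a : R) (i : ℕ)
    (hK : ∀ z : HH I (Submodule.torsionBy R M r) (i+1), z = 0)
    (hQ : ∀ z : HH I (M ⧸ (Ideal.span {r} • ⊤ : Submodule R M)) i, a • z = 0)
    (z : HH I M (i+1)) (hz : r • z = 0) : a • z = 0 := by
  have h1 : ∀ v ∈ Submodule.torsionBy R M r, r • v = 0 := fun v hv => hv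
  obtain ⟨g, hg⟩ := exA (mB_exact _ r h1) (mB_inj _ r h1 (fun v hv => hv))
    (Submodule.mkQ_surjective _) i (mL (Submodule.torsionBy R M r).mkQ (i+1) z)
    (by rw [mB_mkQ, hz])
  apply mkQ_inj _ _ hK
  rw [map_smul, ← hg, ← map_smul, hQ g, map_zero]

variable [IsLocalRing R] [IsNoetherianRing R]

lemma isSOP_cons_quot {M : Type u} [AddCommGroup M] [Module R M] [Module.Finite R M] {d : ℕ} {x : R}
    {y : Fin d → R} (h : IsSOP R M (d+1) (Fin.cons x y)) :
    IsSOP R (M ⧸ (Ideal.span {x} • ⊤ : Submodule R M)) d y := by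
  rw [isSOP_iff] at h ⊢
  rw [span_range_cons] at h
  refine ⟨fun i => by simpa using h.1 i.succ, (par_quot _ _).2 h.2⟩

theorem b_kills (i : ℕ) : ∀ {M : Type u} [AddCommGroup M] [Module R M] [Module.Finite R M] {d : ℕ}
    {y : Fin d → R} (_ : IsSOP R M d y) {a : R} (_ : a ∈ bIdeal R M d) (_ : i < d)
    (z : HH (maximalIdeal R) M i), a • z = 0 := by
  induction i with
  | zero =>
    intro M _ _ _ d y hy a ha hd z
    obtain ⟨d, rfl⟩ : ∃ e, d = e + 1 := ⟨d - 1, by lia⟩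
    obtain ⟨x, hxm, hx, -⟩ := exists_param hy
    obtain ⟨n, hn⟩ := HH_torsion z
    apply e0_inj
    rw [map_smul, map_zero]
    refine bIdeal_first (hx n) ha ?_
    rw [← map_smul, hn, map_zero]
    exact Ideal.pow_le_pow_right (Nat.le_succ n) (Ideal.pow_mem_pow hxm _)
  | succ i ih =>
    intro M _ _ _ d y hy a ha hd z
    obtain ⟨d, rfl⟩ : ∃ e, d = e + 1 := ⟨d - 1, by lia⟩
    obtain ⟨x, hxm, hx, hass⟩ := exists_param hy
    obtain ⟨n, hn⟩ := HH_torsion z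
    have hxn : x ^ (n+1) ∈ maximalIdeal R := Ideal.pow_mem_of_mem _ hxm _ (Nat.succ_pos n)
    refine chase (x ^ (n+1)) a i ?_ ?_ z
      (hn _ (Ideal.pow_le_pow_right (Nat.le_succ n) (Ideal.pow_mem_pow hxm _)))
    · obtain ⟨k, hk⟩ := par_tors (par_ker (n+1) hass (Submodule.torsionBy R M (x ^ (n+1)))
        (fun v hv => hv))
      exact HH_van (fun v => ⟨k, fun r hr => hk r hr v⟩) i
    · exact ih (isSOP_cons_quot (hx n)) (bIdeal_quot hxn ha) (by lia)

theorem van_par (s : ℕ) : ∀ {N : Type u} [AddCommGroup N] [Module R N] [Module.Finite R N]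
    {y : Fin s → R} (_ : ∀ i, y i ∈ maximalIdeal R) (_ : Par N (Ideal.span (Set.range y)))
    (i : ℕ) (_ : s ≤ i) (z : HH (maximalIdeal R) N (i+1)), z = 0 := by
  induction s with
  | zero =>
    intro N _ _ _ y hy h i hi z
    rw [Set.range_eq_empty, Ideal.span_empty] at h
    obtain ⟨k, hk⟩ := par_tors h
    exact HH_van (fun v => ⟨k, fun r hr => hk r hr v⟩) i z
  | succ s ih =>
    intro N _ _ _ y hy h i hi z
    obtain ⟨n, hn⟩ := HH_torsion z
    have hyn : y 0 ^ n ∈ maximalIdeal R ^ n := Ideal.pow_mem_pow (hy 0) _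
    obtain ⟨i, rfl⟩ : ∃ j, i = j + 1 := ⟨i - 1, by lia⟩
    rw [← Fin.cons_self_tail y, span_range_cons] at h
    have hp1 : Par (Submodule.torsionBy R N (y 0 ^ n)) (Ideal.span (Set.range (Fin.tail y))) := by
      intro p hp h1 h2
      refine h p hp (sup_le ?_ h1) ?_
      · rw [Ideal.span_singleton_le_iff_mem]
        exact hp.mem_of_pow_mem n (h2 (Module.mem_annihilator.2 fun v => Subtype.ext v.2))
      · refine le_trans ?_ h2
        exact LinearMap.annihilator_le_of_injective (Submodule.subtype _)
          (Submodule.subtype_injective _)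
    have hp2 : Par (N ⧸ (Ideal.span {y 0 ^ n} • ⊤ : Submodule R N))
        (Ideal.span (Set.range (Fin.tail y))) := by
      rw [par_quot]
      intro p hp h1 h2
      rw [sup_le_iff, Ideal.span_singleton_le_iff_mem] at h1
      refine h p hp (sup_le ?_ h1.2) h2
      rw [Ideal.span_singleton_le_iff_mem]
      exact hp.mem_of_pow_mem n h1.1
    have := chase (y 0 ^ n) 1 (i+1) (ih (fun j => hy _) hp1 _ (by lia))
      (fun z => by rw [one_smul]; exact ih (fun j => hy _) hp2 _ (by lia) z) z (hn _ hyn)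
    rwa [one_smul] at this

end Van2
end
end LC

namespace LC

noncomputable section

section Step
variable {R : Type u} [CommRing R]

lemma mul_rep (b J : Ideal R) {x : R} (hx : x ∈ b * J) : ∃ (ι : Type) (_ : Fintype ι)
    (a y : ι → R), (∀ j, a j ∈ b) ∧ (∀ j, y j ∈ J) ∧ x = ∑ j, a j * y j := by
  refine Submodule.mul_induction_on hx ?_ ?_
  · intro m hm n hn
    exact ⟨Unit, inferInstance, fun _ => m, fun _ => n, fun _ => hm, fun _ => hn, by simp⟩
  · rintro p q ⟨ι, _, a, y, h1, h2, rfl⟩ ⟨κ, _, a', y', h1', h2', rfl⟩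
    refine ⟨ι ⊕ κ, inferInstance, Sum.elim a a', Sum.elim y y', ?_, ?_, ?_⟩
    · rintro (j | j)
      · exact h1 j
      · exact h1' j
    · rintro (j | j)
      · exact h2 j
      · exact h2' j
    · rw [Fintype.sum_sum_type]; rfl

variable {M : Type u} [AddCommGroup M] [Module R M] {I : Ideal R}

/-- the key zero-map computation -/
lemma mB_zero (U : Submodule R M) (b : Ideal R) (hbU : ∀ a ∈ b, ∀ v ∈ U, a • v = 0) (i : ℕ)
    (hb : ∀ a ∈ b, ∀ z : HH I M i, a • z = 0) {x : R} (hx : x ∈ b * b) (h : ∀ v ∈ U, x • v = 0)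
    (z : HH I (M ⧸ U) i) : mL (mB U x h) i z = 0 := by
  have key : ∃ h' : ∀ v ∈ U, x • v = 0, mL (mB U x h') i z = 0 := by
    refine Submodule.mul_induction_on hx ?_ ?_
    · intro a ha c hc
      refine ⟨fun v hv => by rw [mul_comm, mul_smul, hbU a ha v hv, smul_zero], ?_⟩
      have : mB U (a * c) (fun v hv => by rw [mul_comm, mul_smul, hbU a ha v hv, smul_zero]) =
          c • mB U a (hbU a ha) := by
        apply Submodule.linearMap_qext
        ext v
        change (a * c) • v = c • a • v
        rw [mul_comm, mul_smul]
      rw [this, mL_smul, hb c hc]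
    · rintro p q ⟨h1, h1'⟩ ⟨h2, h2'⟩
      refine ⟨fun v hv => by rw [add_smul, h1 v hv, h2 v hv, add_zero], ?_⟩
      have : mB U (p + q) (fun v hv => by rw [add_smul, h1 v hv, h2 v hv, add_zero]) =
          mB U p h1 + mB U q h2 := by
        apply Submodule.linearMap_qext
        ext v
        exact add_smul p q v
      rw [this, mL_add, h1', h2', add_zero]
  obtain ⟨_, h'⟩ := key
  exact h'

/-- injectivity of the map to the cohomology of the quotient -/
lemma step_inj (b : Ideal R) (i : ℕ) {x : R} (hx : x ∈ b * b)
    (hbU : ∀ a ∈ b, ∀ v : M, x • v = 0 → a • v = 0)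
    (hb : ∀ a ∈ b, ∀ z : HH I M i, a • z = 0) (z : HH I M i)
    (hz : mL (Ideal.span {x} • ⊤ : Submodule R M).mkQ i z = 0) : z = 0 := by
  have h1 : ∀ v ∈ Submodule.torsionBy R M x, x • v = 0 := fun v hv => hv
  obtain ⟨w, rfl⟩ := exB (mB_exact _ x h1) (mB_inj _ x h1 (fun v hv => hv))
    (Submodule.mkQ_surjective _) i z hz
  exact mB_zero _ b (fun a ha v hv => hbU a ha v hv) i hb hx h1 w

/-- lifting of socle elements -/
lemma step_lift (b J : Ideal R) (d : ℕ) {x : R} (hx : x ∈ b * J)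
    (hJ : ∀ a ∈ J, ∀ v : M, x • v = 0 → a • v = 0) (hJI : J ≤ I)
    (hb : ∀ a ∈ b, ∀ z : HH I M d, a • z = 0)
    (h1 : ∀ v ∈ Submodule.torsionBy R M x, x • v = 0)
    (s : HH I M (d+1)) (hs : ∀ r ∈ I, r • s = 0) :
    ∃ t : HH I (M ⧸ (Ideal.span {x} • ⊤ : Submodule R M)) d, (∀ r ∈ I, r • t = 0) ∧
      dL (mB_exact _ x h1) (mB_inj _ x h1 (fun v hv => hv)) (Submodule.mkQ_surjective _) d t =
        mL (Submodule.torsionBy R M x).mkQ (d+1) s := by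
  classical
  obtain ⟨ι, _, a, y, ha, hy, hxe⟩ := mul_rep b J hx
  have hyU : ∀ j, ∀ v ∈ Submodule.torsionBy R M x, y j • v = 0 := fun j v hv => hJ _ (hy j) v hv
  let F : (M ⧸ Submodule.torsionBy R M x) →ₗ[R] (ι → M) :=
    LinearMap.pi (fun j => mB _ (y j) (hyU j))
  have hF : ∀ v j, F (Submodule.Quotient.mk v) j = y j • v := fun v j => rfl
  let α : (ι → M) →ₗ[R] M := ∑ j, a j • LinearMap.proj j
  have hα : ∀ w, α w = ∑ j, a j • w j := by
    intro w
    simp [α, LinearMap.sum_apply]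
  have hαF : ∀ v, mB (Submodule.torsionBy R M x) x h1 v = α (F v) := by
    intro v
    obtain ⟨v, rfl⟩ := Submodule.Quotient.mk_surjective _ v
    rw [hα, mB_mk]
    simp only [hF, ← mul_smul]
    rw [← Finset.sum_smul, ← hxe]
  have hFinj : Function.Injective F := by
    intro v w hvw
    apply mB_inj _ x h1 (fun v hv => hv)
    rw [hαF, hαF, hvw]
  have hle : LinearMap.range F ≤ (Ideal.span {x} • ⊤ : Submodule R M).comap α := by
    rintro _ ⟨v, rfl⟩
    rw [Submodule.mem_comap, ← hαF]
    obtain ⟨v, rfl⟩ := Submodule.Quotient.mk_surjective _ v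
    exact mem_span_smul.2 ⟨v, rfl⟩
  let β : ((ι → M) ⧸ LinearMap.range F) →ₗ[R] (M ⧸ (Ideal.span {x} • ⊤ : Submodule R M)) :=
    Submodule.mapQ _ _ α hle
  have hex := LinearMap.exact_map_mkQ_range F
  have hFs : mL F (d+1) (mL (Submodule.torsionBy R M x).mkQ (d+1) s) = 0 := by
    rw [mL_comp]
    have : F.comp (Submodule.torsionBy R M x).mkQ =
        ∑ j, y j • LinearMap.single R (fun _ : ι => M) j := by
      apply LinearMap.ext
      intro v
      funext j
      rw [LinearMap.comp_apply, Submodule.mkQ_apply, hF]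
      simp [LinearMap.sum_apply, Finset.sum_apply, Pi.single_apply]
    rw [this, mL_sum]
    apply Finset.sum_eq_zero
    intro j _
    rw [mL_smul, ← map_smul, hs _ (hJI (hy j)), map_zero]
  obtain ⟨z, hz⟩ := exA hex hFinj (Submodule.mkQ_surjective _) d _ hFs
  refine ⟨mL β d z, fun r hr => ?_, ?_⟩
  · rw [← map_smul]
    obtain ⟨w, hw⟩ := exC hex hFinj (Submodule.mkQ_surjective _) d (r • z)
      (by rw [map_smul, hz, ← map_smul, hs r hr, map_zero])
    rw [← hw, mL_comp]
    have : β.comp (LinearMap.range F).mkQ = (Ideal.span {x} • ⊤ : Submodule R M).mkQ.comp α := rfl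
    rw [this, ← mL_comp]
    have : mL α d w = 0 := by
      rw [mL_sum]
      apply Finset.sum_eq_zero
      intro j _
      rw [mL_smul, hb _ (ha j)]
    rw [this, map_zero]
  · rw [dL_nat hex hFinj (Submodule.mkQ_surjective _) (mB_exact _ x h1)
      (mB_inj _ x h1 (fun v hv => hv)) (Submodule.mkQ_surjective _) LinearMap.id α β
      (fun v => hαF v) (fun v => rfl), hz, mL_id]

lemma len_sum {A S B W : Type u} [AddCommGroup A] [Module R A] [AddCommGroup S] [Module R S]
    [AddCommGroup B] [Module R B] [AddCommGroup W] [Module R W] (f : A →ₗ[R] S)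
    (hf : Function.Injective f) (g : S →ₗ[R] W) (k : B →ₗ[R] W) (hk : Function.Injective k)
    (hgf : ∀ a, g (f a) = 0) (hl : ∀ b, ∃ s, g s = k b) :
    Module.length R A + Module.length R B ≤ Module.length R S := by
  have h1 : Module.length R S = Module.length R (LinearMap.ker g) + Module.length R (LinearMap.range g) :=
    Module.length_eq_add_of_exact (LinearMap.ker g).subtype g.rangeRestrict
      (Submodule.subtype_injective _) g.surjective_rangeRestrict (by
        intro s
        constructor
        · intro h
          exact ⟨⟨s, congrArg Subtype.val h⟩, rfl⟩
        · rintro ⟨t, rfl⟩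
          exact Subtype.ext t.2)
  rw [h1]
  refine add_le_add ?_ ?_
  · exact Module.length_le_of_injective (f.codRestrict _ hgf) (fun x y h => hf (congrArg Subtype.val h))
  · refine Module.length_le_of_injective (k.codRestrict (LinearMap.range g) ?_)
      (fun x y h => hk (congrArg Subtype.val h))
    intro b
    obtain ⟨s, hs⟩ := hl b
    exact ⟨s, hs⟩

variable [IsLocalRing R]

/-- socle -/
abbrev soc (N : Type u) [AddCommGroup N] [Module R N] : Submodule R N :=
  Submodule.torsionBySet R N (maximalIdeal R : Set R)

lemma mem_soc {N : Type u} [AddCommGroup N] [Module R N] {v : N} :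
    v ∈ soc (R := R) N ↔ ∀ r ∈ maximalIdeal R, r • v = 0 := by
  rw [Submodule.mem_torsionBySet_iff]
  exact ⟨fun h r hr => h ⟨r, hr⟩, fun h r => h r.1 r.2⟩

/-- induced map on socles -/
def socMap {N N' : Type u} [AddCommGroup N] [Module R N] [AddCommGroup N'] [Module R N']
    (f : N →ₗ[R] N') : soc (R := R) N →ₗ[R] soc (R := R) N' :=
  f.restrict (fun v hv => mem_soc.2 fun r hr => by rw [← map_smul, mem_soc.1 hv r hr, map_zero])

lemma socMap_inj {N N' : Type u} [AddCommGroup N] [Module R N] [AddCommGroup N'] [Module R N']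
    (f : N →ₗ[R] N') (hf : ∀ v, f v = 0 → v = 0) : Function.Injective (socMap f) := by
  rw [injective_iff_map_eq_zero]
  intro v hv
  exact Subtype.ext (hf v.1 (congrArg Subtype.val hv))

/-- length of the socle -/
def lsoc (R : Type u) [CommRing R] [IsLocalRing R] (N : Type u) [AddCommGroup N] [Module R N] : ℕ∞ :=
  Module.length R (soc (R := R) N)

lemma lsoc_le {N N' : Type u} [AddCommGroup N] [Module R N] [AddCommGroup N'] [Module R N']
    (f : N →ₗ[R] N') (hf : ∀ v, f v = 0 → v = 0) : lsoc R N ≤ lsoc R N' :=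
  Module.length_le_of_injective _ (socMap_inj f hf)

variable [IsNoetherianRing R] [Module.Finite R M]

lemma step_a {d : ℕ} {x : R} {y : Fin d → R} (h : IsSOP R M (d+1) (Fin.cons x y))
    (hx : x ∈ bIdeal R M (d+1) ^ 3) {i : ℕ} (hi : i < d + 1) (z : HH (maximalIdeal R) M i)
    (hz : mL (Ideal.span {x} • ⊤ : Submodule R M).mkQ i z = 0) : z = 0 := by
  refine step_inj (bIdeal R M (d+1)) i ?_ (fun a ha v hv => bIdeal_first h ha hv)
    (fun a ha z => b_kills i h ha hi z) z hz
  rw [← pow_two]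
  exact Ideal.pow_le_pow_right (by lia) hx

lemma step_b {d : ℕ} {x : R} {y : Fin d → R} (h : IsSOP R M (d+1) (Fin.cons x y))
    (hx : x ∈ bIdeal R M (d+1) ^ 3) :
    lsoc R (HH (maximalIdeal R) M d) + lsoc R (HH (maximalIdeal R) M (d+1)) ≤
      lsoc R (HH (maximalIdeal R) (M ⧸ (Ideal.span {x} • ⊤ : Submodule R M)) d) := by
  have hxm : x ∈ maximalIdeal R := by simpa using h.1 0
  have h1 : ∀ v ∈ Submodule.torsionBy R M x, x • v = 0 := fun v hv => hv
  have hx2 : x ∈ bIdeal R M (d+1) * (bIdeal R M (d+1) ⊓ maximalIdeal R) := by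
    by_cases hb : bIdeal R M (d+1) = ⊤
    · rw [hb, top_inf_eq, Ideal.top_mul]; exact hxm
    · have := IsLocalRing.le_maximalIdeal hb
      rw [inf_eq_left.2 this, ← pow_two]
      exact Ideal.pow_le_pow_right (by lia) hx
  have hU : ∀ z : HH (maximalIdeal R) (Submodule.torsionBy R M x) (d+1), z = 0 := by
    have h2 := isSOP_iff.1 h
    rw [span_range_cons] at h2
    refine van_par d (y := y) (fun j => by simpa using h2.1 j.succ) ?_ d le_rfl
    intro p hp h3 h4
    refine h2.2 p hp (sup_le ?_ h3) ?_
    · rw [Ideal.span_singleton_le_iff_mem]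
      exact h4 (Module.mem_annihilator.2 fun v => Subtype.ext v.2)
    · refine le_trans ?_ h4
      exact LinearMap.annihilator_le_of_injective (Submodule.subtype _)
        (Submodule.subtype_injective _)
  refine len_sum (socMap (mL (Ideal.span {x} • ⊤ : Submodule R M).mkQ d))
    (socMap_inj _ (fun v hv => step_a h hx (by lia) v hv))
    ((dL (mB_exact _ x h1) (mB_inj _ x h1 (fun v hv => hv)) (Submodule.mkQ_surjective _) d).comp
      (Submodule.subtype _))
    ((mL (Submodule.torsionBy R M x).mkQ (d+1)).comp (Submodule.subtype _)) ?_ ?_ ?_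
  · rw [injective_iff_map_eq_zero]
    intro v hv
    exact Subtype.ext (mkQ_inj _ _ hU v.1 hv)
  · intro v
    exact dL_mL (mB_exact _ x h1) (mB_inj _ x h1 (fun v hv => hv)) (Submodule.mkQ_surjective _) d v.1
  · intro s
    obtain ⟨t, ht, ht2⟩ := step_lift (bIdeal R M (d+1)) (bIdeal R M (d+1) ⊓ maximalIdeal R) d hx2
      (fun a ha v hv => bIdeal_first h ha.1 hv) inf_le_right
      (fun a ha z => b_kills d h ha (by lia) z) h1 s.1 (mem_soc.1 s.2)
    exact ⟨⟨t, mem_soc.2 ht⟩, ht2⟩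

end Step
end
end LC

namespace LC

noncomputable section

section Final
variable {R : Type u} [CommRing R] [IsLocalRing R]

lemma lsoc_eq_toENat (N : Type u) [AddCommGroup N] [Module R N] :
    lsoc R N = Cardinal.toENat (Module.rank (R ⧸ maximalIdeal R) (soc (R := R) N)) := by
  letI : Field (R ⧸ maximalIdeal R) := Ideal.Quotient.field _
  have h1 := Module.length_eq_of_surjective (R := R ⧸ maximalIdeal R) (S := R)
    (M := soc (R := R) N) Ideal.Quotient.mk_surjective
  rw [Module.length_eq_rank] at h1
  exact h1

lemma socDim_le (N : Type u) [AddCommGroup N] [Module R N] :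
    ((socDim R (maximalIdeal R) N : ℕ) : ℕ∞) ≤ lsoc R N := by
  rw [lsoc_eq_toENat]
  unfold socDim Module.finrank
  rw [Cardinal.toNat]
  exact ENat.natCast_toNat_le_self _

lemma le_socDim (N : Type u) [AddCommGroup N] [Module R N] (h : lsoc R N ≠ ⊤) :
    lsoc R N = ((socDim R (maximalIdeal R) N : ℕ) : ℕ∞) := by
  rw [lsoc_eq_toENat] at h ⊢
  unfold socDim Module.finrank
  rw [Cardinal.toNat]
  exact (ENat.natCast_toNat h).symm

/-- all entries but the last one -/
def front {d : ℕ} (x : Fin (d+1) → R) : Fin d → R := fun j => x j.castSucc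

lemma insert_front {d : ℕ} (x : Fin (d+1) → R) :
    insert (x (Fin.last d)) (Set.range (front x)) = Set.range x := by
  ext r
  constructor
  · rintro (rfl | ⟨j, rfl⟩)
    · exact ⟨_, rfl⟩
    · exact ⟨_, rfl⟩
  · rintro ⟨j, rfl⟩
    induction j using Fin.lastCases with
    | last => exact Or.inl rfl
    | cast j => exact Or.inr ⟨j, rfl⟩

lemma csop_restrict [IsNoetherianRing R] {M : Type u} [AddCommGroup M] [Module R M] [Module.Finite R M]
    {d : ℕ} {x : Fin (d+1) → R} (h : IsCSOP R M (d+1) x) :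
    IsSOP R M (d+1) (Fin.cons (x (Fin.last d)) (front x)) ∧
    x (Fin.last d) ∈ bIdeal R M (d+1) ^ 3 ∧
    IsCSOP R (M ⧸ (Ideal.span {x (Fin.last d)} • ⊤ : Submodule R M)) d (front x) := by
  have hs : Ideal.span (Set.range (Fin.cons (x (Fin.last d)) (front x) : Fin (d+1) → R)) =
      Ideal.span (Set.range x) := by
    congr 1
    rw [Fin.range_cons, insert_front]
  have h1 : IsSOP R M (d+1) (Fin.cons (x (Fin.last d)) (front x)) := by
    refine ⟨fun i => ?_, ?_⟩
    · refine Fin.cases ?_ (fun j => ?_) i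
      · rw [Fin.cons_zero]; exact h.1.1 _
      · rw [Fin.cons_succ]; exact h.1.1 _
    · rw [hs]; exact h.1.2
  refine ⟨h1, ?_, isSOP_cons_quot h1, fun i => ?_⟩
  · have h2 := h.2 (Fin.last d)
    have he : {j : Fin (d+1) | Fin.last d < j} = ∅ := by
      ext j
      simpa using Fin.le_last j
    rw [he, Set.image_empty, Ideal.span_empty, Submodule.bot_smul,
      bIdeal_equiv (Submodule.quotEquivOfEqBot (⊥ : Submodule R M) rfl)] at h2
    exact h2
  · have h2 := h.2 i.castSucc
    have hI : Ideal.span (x '' {j | i.castSucc < j}) =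
        Ideal.span {x (Fin.last d)} ⊔ Ideal.span (front x '' {j | i < j}) := by
      rw [← Ideal.span_union]
      congr 1
      ext r
      simp only [Set.mem_image, Set.mem_ofPred_eq, Set.mem_union, Set.mem_singleton_iff]
      constructor
      · rintro ⟨j, hj, rfl⟩
        induction j using Fin.lastCases with
        | last => exact Or.inl rfl
        | cast j => exact Or.inr ⟨j, by simpa using hj, rfl⟩
      · rintro (rfl | ⟨j, hj, rfl⟩)
        · exact ⟨Fin.last d, Fin.castSucc_lt_last i, rfl⟩
        · exact ⟨j.castSucc, by simpa using hj, rfl⟩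
    rw [hI, ← bIdeal_equiv (qq M _ _)] at h2
    exact h2

theorem main [IsNoetherianRing R] (d : ℕ) : ∀ {M : Type u} [AddCommGroup M] [Module R M]
    [Module.Finite R M] {x : Fin d → R} (_ : IsCSOP R M d x),
    ∑ i ∈ Finset.range (d + 1), lsoc R (HH (maximalIdeal R) M i) ≤
      lsoc R (M ⧸ (Ideal.span (Set.range x) • ⊤ : Submodule R M)) := by
  induction d with
  | zero =>
    intro M _ _ _ x h
    rw [zero_add, Finset.sum_range_one]
    refine lsoc_le ((Submodule.mkQ _).comp (e0 (maximalIdeal R) M)) (fun v hv => ?_)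
    rw [LinearMap.comp_apply, Submodule.mkQ_apply, Submodule.Quotient.mk_eq_zero,
      Set.range_eq_empty, Ideal.span_empty, Submodule.bot_smul, Submodule.mem_bot] at hv
    exact e0_inj _ _ (by rw [hv, map_zero])
  | succ d ih =>
    intro M _ _ _ x h
    obtain ⟨h1, h2, h3⟩ := csop_restrict h
    have h4 := ih h3
    have hI : Ideal.span (Set.range x) =
        Ideal.span {x (Fin.last d)} ⊔ Ideal.span (Set.range (front x)) := by
      rw [← span_range_cons, Fin.range_cons, insert_front]
    have h5 : lsoc R ((M ⧸ (Ideal.span {x (Fin.last d)} • ⊤ : Submodule R M)) ⧸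
        (Ideal.span (Set.range (front x)) • ⊤ : Submodule R
          (M ⧸ (Ideal.span {x (Fin.last d)} • ⊤ : Submodule R M)))) ≤
        lsoc R (M ⧸ (Ideal.span (Set.range x) • ⊤ : Submodule R M)) := by
      rw [hI]
      exact lsoc_le (qq M _ _).toLinearMap (fun v hv => (LinearEquiv.map_eq_zero_iff _).1 hv)
    refine le_trans ?_ (h4.trans h5)
    rw [Finset.sum_range_succ, Finset.sum_range_succ, Finset.sum_range_succ, add_assoc]
    refine add_le_add (Finset.sum_le_sum fun i hi => ?_) (step_b h1 h2)
    have := Finset.mem_range.1 hi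
    exact lsoc_le _ (fun v hv => step_a h1 h2 (by lia) v hv)

theorem final [IsNoetherianRing R] (M : Type u) [AddCommGroup M] [Module R M] [Module.Finite R M]
    (d : ℕ) (x : Fin d → R) (hx : IsCSOP R M d x) :
    ∑ i ∈ Finset.range (d + 1), socH R M i ≤ ir R M (Ideal.span (Set.range x)) := by
  have h1 := main d hx
  have hfin : lsoc R (M ⧸ (Ideal.span (Set.range x) • ⊤ : Submodule R M)) ≠ ⊤ := by
    unfold lsoc
    rw [Module.length_ne_top_iff]
    exact IsFiniteLength.of_injective hx.1.2 (Submodule.subtype_injective _)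
  rw [le_socDim _ hfin] at h1
  have h2 : ((∑ i ∈ Finset.range (d + 1), socH R M i : ℕ) : ℕ∞) ≤
      ∑ i ∈ Finset.range (d + 1), lsoc R (HH (maximalIdeal R) M i) := by
    rw [Nat.cast_sum]
    refine Finset.sum_le_sum fun i _ => ?_
    refine (socDim_le _).trans ?_
    exact lsoc_le (N' := HH (maximalIdeal R) M i)
      (compareH (maximalIdeal R) (ModuleCat.of R M) i).symm.toLinearMap
      (fun v hv => (LinearEquiv.map_eq_zero_iff _).1 hv)
  exact_mod_cast h2.trans h1

end Final
end
end LC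

/-- `N_R(M) ≥ Σ_{i=0}^{d} dim_k Soc(H^i_m(M))`. -/
theorem stmt2 (R : Type u) [CommRing R] [IsLocalRing R] [IsNoetherianRing R]
    (hCM : IsQuotientOfCMLocalRing R)
    (M : Type u) [AddCommGroup M] [Module R M] [Module.Finite R M]
    (d : ℕ) (hd : 0 < d) (hdim : mdim R M = d)
    (x : Fin d → R) (hx : IsCSOP R M d x) :
    ∑ i ∈ Finset.range (d + 1), socH R M i ≤ ir R M (Ideal.span (Set.range x)) := by
  exact LC.final M d x hx
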